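/- arXiv:1307.5484 — 8 statements merged into one kernel-verified Lean document; each statement's English description precedes it below -/
import Mathlib

section
/- For every integer n ≥ 8, let ℓ = 7 if n ≠ 14 and ℓ = 9 if n = 14. Then there exist positive integers a and b, real numbers α, β ∈ (0, π/2) and a real number u > 0 such that ℓ·α + (n−ℓ)·β = π, sin α = a·u, sin β = b·u, and u does not belong to Qclo(ℚ). (This expresses that the cyclic n-gon with ℓ sides of length a and n−ℓ sides of length b exists but is not constructible with straightedge and compass from its side lengths, i.e., n ∈ NCL₂.) -/
open Real

/-- The real quadratic closure of a subfield `K` of `ℝ`: the smallest subfield of `ℝ`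
containing `K` that is closed under real square roots. -/
noncomputable def Qclo (K : Subfield ℝ) : Subfield ℝ :=
  sInf {M : Subfield ℝ | K ≤ M ∧ ∀ c : ℝ, c ∈ M → 0 ≤ c → Real.sqrt c ∈ M}

namespace Valuation

variable {K Γ : Type*} [Field K] [LinearOrderedCommGroupWithZero Γ] (v : Valuation K Γ)

lemma map_natCast_le_one (n : ℕ) : v n ≤ 1 := by
  induction n with
  | zero => simp
  | succ n ih =>
    rw [Nat.cast_succ]
    exact v.map_add_le ih v.map_one.le

lemma map_intCast_le_one (n : ℤ) : v n ≤ 1 := by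
  obtain ⟨n, rfl | rfl⟩ := n.eq_nat_or_neg
  · simpa using v.map_natCast_le_one n
  · simpa using v.map_natCast_le_one n

lemma map_aeval_le_one {x : K} (hx : v x ≤ 1) (q : Polynomial ℤ) :
    v (Polynomial.aeval x q) ≤ 1 := by
  induction q using Polynomial.induction_on' with
  | add p q hp hq =>
    rw [map_add]
    exact v.map_add_le hp hq
  | monomial n a =>
    rw [Polynomial.aeval_monomial, map_mul, map_pow]
    exact mul_le_one' (by simpa using v.map_intCast_le_one a) (pow_le_one' hx n)

variable {v} {p : ℕ}

lemma map_intCast_lt_one (hv : v p < 1) {n : ℤ} (hn : (p : ℤ) ∣ n) : v n < 1 := by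
  obtain ⟨c, rfl⟩ := hn
  rw [Int.cast_mul, map_mul, Int.cast_natCast]
  exact (mul_le_of_le_one_right' (v.map_intCast_le_one c)).trans_lt hv

lemma map_intCast_eq_one (hp : p.Prime) (hv : v p < 1) {n : ℤ} (hn : ¬ (p : ℤ) ∣ n) :
    v n = 1 := by
  obtain ⟨a, b, hab⟩ := (Nat.prime_iff_prime_int.mp hp).coprime_iff_not_dvd.mpr hn
  refine le_antisymm (v.map_intCast_le_one n) (not_lt.mp fun hlt => ?_)
  have h : v ((a : K) * p + b * n) < 1 := by
    refine v.map_add_lt ?_ ?_ <;> rw [map_mul]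
    · exact (mul_le_of_le_one_left' (v.map_intCast_le_one a)).trans_lt hv
    · exact (mul_le_of_le_one_left' (v.map_intCast_le_one b)).trans_lt hlt
  have h1 : (a : K) * p + b * n = 1 := by exact_mod_cast congrArg (Int.cast (R := K)) hab
  rw [h1, map_one] at h
  exact lt_irrefl _ h

variable (v p) in
/-- The value of `x` is a power of the value of `p`, with exponent a dyadic rational. -/
def HasDyadicValue (x : K) : Prop := ∃ (k : ℕ) (z : ℤ), v x ^ (2 ^ k) = v p ^ z

namespace HasDyadicValue

lemma of_eq_one {x : K} (h : v x = 1) : v.HasDyadicValue p x := ⟨0, 0, by simp [h]⟩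

lemma congr {x y : K} (h : v.HasDyadicValue p x) (hxy : v y = v x) : v.HasDyadicValue p y := by
  obtain ⟨k, z, h⟩ := h
  exact ⟨k, z, by rw [hxy, h]⟩

lemma mul {x y : K} (hp0 : (p : K) ≠ 0) (hx : v.HasDyadicValue p x)
    (hy : v.HasDyadicValue p y) : v.HasDyadicValue p (x * y) := by
  obtain ⟨k, z, hk⟩ := hx
  obtain ⟨l, w, hl⟩ := hy
  have h0 : v p ≠ 0 := (v.ne_zero_iff).mpr hp0
  refine ⟨k + l, z * (2 ^ l : ℕ) + w * (2 ^ k : ℕ), ?_⟩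
  rw [map_mul, mul_pow, zpow_add₀ h0, zpow_mul, zpow_mul, ← hk, ← hl, zpow_natCast, zpow_natCast,
    ← pow_mul, ← pow_mul, pow_add, mul_comm (2 ^ l) (2 ^ k)]

lemma inv {x : K} (hx : v.HasDyadicValue p x) : v.HasDyadicValue p x⁻¹ := by
  obtain ⟨k, z, hk⟩ := hx
  exact ⟨k, -z, by rw [map_inv₀, inv_pow, hk, zpow_neg]⟩

lemma of_sq {x : K} (hx : v.HasDyadicValue p (x ^ 2)) : v.HasDyadicValue p x := by
  obtain ⟨k, z, hk⟩ := hx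
  exact ⟨k + 1, z, by rw [← hk, map_pow, ← pow_mul, pow_succ']⟩

lemma intCast (hp : p.Prime) (hv : v p < 1) {n : ℤ} (hn : n ≠ 0) :
    v.HasDyadicValue p (n : K) := by
  obtain ⟨m, hk, hm⟩ := (Int.finiteMultiplicity_iff (a := p) (b := n)).mpr
    ⟨by simpa using hp.ne_one, hn⟩ |>.exists_eq_pow_mul_and_not_dvd
  generalize multiplicity (p : ℤ) n = k at hk
  subst hk
  exact ⟨0, k, by simp [map_intCast_eq_one hp hv hm]⟩

/-- The values stay dyadic when passing to a quadratic extension, in odd residue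
characteristic. -/
lemma one_add {t : K} (hv2 : v 2 = 1) (ht : v.HasDyadicValue p t)
    (ht2 : v.HasDyadicValue p (1 - t ^ 2)) :
    v.HasDyadicValue p (1 + t) := by
  rcases lt_trichotomy (v t) 1 with h | h | h
  · exact of_eq_one (v.map_one_add_of_lt h)
  · rcases (v.map_add_le v.map_one.le h.le).lt_or_eq with h1 | h1
    · have h2 : v (1 - t) = 1 := by
        rw [show 1 - t = 2 - (1 + t) by ring, v.map_sub_eq_of_lt_left (by rwa [hv2]), hv2]
      refine ht2.congr ?_
      rw [show 1 - t ^ 2 = (1 + t) * (1 - t) by ring, map_mul, h2, mul_one]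
    · exact of_eq_one h1
  · exact ht.congr (v.map_add_eq_of_lt_right (by rwa [map_one]))

end HasDyadicValue

end Valuation

/-- The subfield obtained from `M` by adjoining a square root `s ∉ M` of an element of `M`. -/
def Subfield.adjoinSqrt {K : Type*} [Field K] (M : Subfield K) (s : K) (hs : s ^ 2 ∈ M)
    (hsM : s ∉ M) : Subfield K where
  carrier := {x | ∃ a ∈ M, ∃ b ∈ M, x = a + b * s}
  zero_mem' := ⟨0, M.zero_mem, 0, M.zero_mem, by simp⟩
  one_mem' := ⟨1, M.one_mem, 0, M.zero_mem, by simp⟩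
  add_mem' := by
    rintro _ _ ⟨a, ha, b, hb, rfl⟩ ⟨c, hc, d, hd, rfl⟩
    exact ⟨a + c, M.add_mem ha hc, b + d, M.add_mem hb hd, by ring⟩
  neg_mem' := by
    rintro _ ⟨a, ha, b, hb, rfl⟩
    exact ⟨-a, M.neg_mem ha, -b, M.neg_mem hb, by ring⟩
  mul_mem' := by
    rintro _ _ ⟨a, ha, b, hb, rfl⟩ ⟨c, hc, d, hd, rfl⟩
    exact ⟨a * c + b * d * s ^ 2, M.add_mem (M.mul_mem ha hc) (M.mul_mem (M.mul_mem hb hd) hs),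
      a * d + b * c, M.add_mem (M.mul_mem ha hd) (M.mul_mem hb hc), by ring⟩
  inv_mem' := by
    rintro _ ⟨a, ha, b, hb, rfl⟩
    have hN : a ^ 2 - b ^ 2 * s ^ 2 ∈ M :=
      M.sub_mem (M.pow_mem ha 2) (M.mul_mem (M.pow_mem hb 2) hs)
    refine ⟨a / (a ^ 2 - b ^ 2 * s ^ 2), M.div_mem ha hN, -b / (a ^ 2 - b ^ 2 * s ^ 2),
      M.div_mem (M.neg_mem hb) hN, ?_⟩
    by_cases h1 : a + b * s = 0
    · have hb0 : b = 0 := by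
        by_contra hb0
        refine hsM ?_
        rw [show s = -a / b by field_simp; linear_combination h1]
        exact M.div_mem (M.neg_mem ha) hb
      simp_all
    · by_cases h2 : a - b * s = 0
      · have hb0 : b = 0 := by
          by_contra hb0
          refine hsM ?_
          rw [show s = a / b by field_simp; linear_combination -h2]
          exact M.div_mem ha hb
        simp_all
      · have h3 : a ^ 2 - b ^ 2 * s ^ 2 ≠ 0 := by
          rw [show a ^ 2 - b ^ 2 * s ^ 2 = (a + b * s) * (a - b * s) by ring]
          exact mul_ne_zero h1 h2
        field_simp
        ring

open Valuation in
lemma Subfield.hasDyadicValue_of_mem_adjoinSqrt {K Γ : Type*} [Field K]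
    [LinearOrderedCommGroupWithZero Γ] {v : Valuation K Γ} {p : ℕ} (hp0 : (p : K) ≠ 0)
    (hv2 : v 2 = 1) {M : Subfield K}
    (hM : ∀ x ∈ M, x ≠ 0 → v.HasDyadicValue p x) {s : K} (hs : s ^ 2 ∈ M) (hsM : s ∉ M)
    {x : K} (hx : x ∈ M.adjoinSqrt s hs hsM) (hx0 : x ≠ 0) : v.HasDyadicValue p x := by
  obtain ⟨a, ha, b, hb, rfl⟩ := hx
  by_cases hb0 : b = 0
  · subst hb0
    simp only [zero_mul, add_zero] at hx0 ⊢
    exact hM a ha hx0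
  have hs0 : s ≠ 0 := fun h => hsM (h ▸ M.zero_mem)
  have hsv : v.HasDyadicValue p s := (hM _ hs (pow_ne_zero 2 hs0)).of_sq
  have hbs : v.HasDyadicValue p (b * s) := (hM b hb hb0).mul hp0 hsv
  by_cases ha0 : a = 0
  · simpa [ha0] using hbs
  have key : v.HasDyadicValue p (1 + b * s / a) := by
    have hmem : 1 - (b * s / a) ^ 2 ∈ M := by
      rw [show (b * s / a) ^ 2 = b ^ 2 * s ^ 2 / a ^ 2 by ring]
      exact M.sub_mem M.one_mem (M.div_mem (M.mul_mem (M.pow_mem hb 2) hs) (M.pow_mem ha 2))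
    refine HasDyadicValue.one_add hv2 ?_ (hM _ hmem fun h => ?_)
    · rw [div_eq_mul_inv]
      exact hbs.mul hp0 (hM a ha ha0).inv
    · have h' : (b * s / a - 1) * (b * s / a + 1) = 0 := by linear_combination -h
      rcases mul_eq_zero.mp h' with h' | h'
      · refine hsM ?_
        rw [show s = a / b by field_simp at h' ⊢; linear_combination h']
        exact M.div_mem ha hb
      · refine hx0 ?_
        field_simp at h'
        linear_combination h'
  rw [show a + b * s = a * (1 + b * s / a) by field_simp]
  exact (hM a ha ha0).mul hp0 key

lemma hasDyadicValue_of_mem_bot {K Γ : Type*} [Field K] [CharZero K]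
    [LinearOrderedCommGroupWithZero Γ] {v : Valuation K Γ} {p : ℕ} (hp : p.Prime)
    (hv : v p < 1) {x : K} (hx : x ∈ (⊥ : Subfield K)) (hx0 : x ≠ 0) :
    v.HasDyadicValue p x := by
  rw [Subfield.bot_eq_of_charZero] at hx
  obtain ⟨q, rfl⟩ := hx
  have hq : q ≠ 0 := by rintro rfl; simp at hx0
  rw [eq_ratCast, Rat.cast_def, div_eq_mul_inv]
  refine .mul (by exact_mod_cast hp.ne_zero) (.intCast hp hv (by simpa using hq)) (.inv ?_)
  exact_mod_cast Valuation.HasDyadicValue.intCast (v := v) hp hv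
    (n := q.den) (by exact_mod_cast q.den_ne_zero)

/-- In odd residue characteristic, every nonzero element of the real quadratic closure of `ℚ` has
a dyadic value, for every valuation of `ℝ`. -/
lemma hasDyadicValue_of_mem_Qclo {Γ : Type*} [LinearOrderedCommGroupWithZero Γ]
    {v : Valuation ℝ Γ} {p : ℕ} (hp : p.Prime) (hp2 : p ≠ 2) (hv : v p < 1) {x : ℝ}
    (hx : x ∈ Qclo ⊥) (hx0 : x ≠ 0) : v.HasDyadicValue p x := by
  obtain ⟨M, -, hM, hmax⟩ := zorn_le_nonempty₀
    {M : Subfield ℝ | ∀ x ∈ M, x ≠ 0 → v.HasDyadicValue p x}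
    (fun c hc hchain y hy => ⟨sSup c, fun x hx hx0 => by
      obtain ⟨N, hN, hxN⟩ :=
        (Subfield.mem_sSup_of_directedOn ⟨y, hy⟩ hchain.directedOn).mp hx
      exact hc hN x hxN hx0, fun z hz => le_sSup hz⟩)
    ⊥ (fun x hx hx0 => hasDyadicValue_of_mem_bot hp hv hx hx0)
  have hle : Qclo ⊥ ≤ M := by
    refine sInf_le ⟨bot_le, fun c hc hc0 => ?_⟩
    by_contra hcM
    have hsq : Real.sqrt c ^ 2 ∈ M := by rwa [Real.sq_sqrt hc0]
    have hv2 : v 2 = 1 := by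
      refine mod_cast Valuation.map_intCast_eq_one hp hv (n := 2) fun h => hp2 ?_
      exact (Nat.prime_dvd_prime_iff_eq hp Nat.prime_two).mp (by exact_mod_cast h)
    refine hcM (hmax (y := M.adjoinSqrt (Real.sqrt c) hsq hcM) (fun x hx hx0 =>
      Subfield.hasDyadicValue_of_mem_adjoinSqrt (by exact_mod_cast hp.ne_zero) hv2 hM hsq hcM
        hx hx0) (fun x hx => ⟨x, hx, 0, M.zero_mem, by simp⟩)
      ⟨0, M.zero_mem, 1, M.one_mem, by simp⟩)
  exact hM x (hle hx) hx0

/-- A value with a cubic ramification is not dyadic. -/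
lemma notMem_Qclo_of_pow_three {Γ : Type*} [LinearOrderedCommGroupWithZero Γ]
    {v : Valuation ℝ Γ} {p : ℕ} (hp : p.Prime) (hp2 : p ≠ 2) (hv : v p < 1) {x : ℝ}
    (hx : v x ^ 3 = v p) : x ∉ Qclo ⊥ := by
  intro hmem
  have hvp : 0 < v p := zero_lt_iff.mpr ((v.ne_zero_iff).mpr (by exact_mod_cast hp.ne_zero))
  have hx0 : x ≠ 0 := by
    rintro rfl
    simp [← hx] at hvp
  obtain ⟨k, z, hk⟩ := hasDyadicValue_of_mem_Qclo hp hp2 hv hmem hx0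
  have h : v p ^ ((2 ^ k : ℕ) : ℤ) = v p ^ (z * (3 : ℕ)) := by
    rw [zpow_natCast, zpow_mul, ← hk, zpow_natCast, ← pow_mul, mul_comm, pow_mul, hx]
  have h2 := zpow_right_injective₀ hvp hv.ne h
  have h3 : 3 ∣ 2 ^ k := by
    rw [← Int.natCast_dvd_natCast]
    exact ⟨z, by rw [h2]; ring⟩
  have := Nat.prime_three.dvd_of_dvd_pow h3
  omega

open Polynomial in
/-- If no integer polynomial with constant term congruent to `1` modulo `p` vanishes at `x`, then
some valuation is positive at both `p` and `x`. -/
lemma exists_valuationSubring_lt_one {K : Type*} [Field K] {p : ℕ} (x : K)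
    (hx : ∀ h : ℤ[X], aeval x h = 0 → (p : ℤ) ∣ h.coeff 0 - 1 → False) :
    ∃ B : ValuationSubring K, B.valuation p < 1 ∧ B.valuation x < 1 := by
  let A : Subring K := (aeval (R := ℤ) x).toRingHom.range
  have hmem (q : ℤ[X]) : aeval x q ∈ A := ⟨q, rfl⟩
  let a : A := ⟨aeval x (C (p : ℤ)), hmem _⟩
  let b : A := ⟨aeval x X, hmem _⟩
  have hI : Ideal.span {a, b} ≠ ⊤ := by
    rw [Ideal.ne_top_iff_one, Ideal.mem_span_pair]
    rintro ⟨⟨_, q, rfl⟩, ⟨_, r, rfl⟩, h⟩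
    have h' := congrArg Subtype.val h
    refine hx (1 - q * C (p : ℤ) - r * X) ?_ ⟨-q.coeff 0, ?_⟩
    · simp only [map_sub, map_mul, map_one]
      simp only [a, b, AlgHom.toRingHom_eq_coe, RingHom.coe_coe, Subring.coe_add, Subring.coe_mul,
        Subring.coe_one] at h'
      linear_combination -h'
    · simp only [coeff_sub, coeff_one_zero, mul_coeff_zero, coeff_C_zero, coeff_X_zero]
      ring
  obtain ⟨B, -, hB⟩ := Ideal.image_subset_nonunits_valuationSubring _ hI
  refine ⟨B, ?_, ?_⟩
  · simpa [a] using B.mem_nonunits_iff.mp (hB ⟨a, Ideal.subset_span (by simp), rfl⟩)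
  · simpa [b] using B.mem_nonunits_iff.mp (hB ⟨b, Ideal.subset_span (by simp), rfl⟩)

lemma exists_valuationSubring_prime_lt_one (K : Type*) [Field K] [CharZero K] {p : ℕ}
    (hp : p.Prime) : ∃ B : ValuationSubring K, B.valuation p < 1 := by
  obtain ⟨B, hB, -⟩ := exists_valuationSubring_lt_one (p := p) (0 : K) fun h hh hdvd => by
    have h0 : h.coeff 0 = 0 := by
      rw [Polynomial.aeval_def, Polynomial.eval₂_at_zero] at hh
      simpa using hh
    rw [h0, zero_sub, dvd_neg] at hdvd
    exact (Nat.prime_iff_prime_int.mp hp).not_dvd_one hdvd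
  exact ⟨B, hB⟩

section Chord

open Polynomial

/-- The polynomial `Q k` with `sin² (kθ) = sin² θ * Q k (4 sin² θ)`. -/
noncomputable def chordSq : ℕ → ℤ[X]
  | 0 => 0
  | 1 => 1
  | k + 2 => 2 + (2 - X) * chordSq (k + 1) - chordSq k

/-- The polynomial `R r` with `sin ((2r+1)θ) = sin θ * R r (4 sin² θ)`. -/
noncomputable def chordOdd : ℕ → ℤ[X]
  | 0 => 1
  | 1 => 3 - X
  | r + 2 => (2 - X) * chordOdd (r + 1) - chordOdd r

lemma sin_mul_sq_eq (θ : ℝ) (k : ℕ) :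
    sin (k * θ) ^ 2 = sin θ ^ 2 * aeval (4 * sin θ ^ 2) (chordSq k) := by
  induction k using chordSq.induct with
  | case1 => simp [chordSq]
  | case2 => simp [chordSq]
  | case3 k ih1 ih2 =>
    simp only [chordSq, map_sub, map_add, map_mul, map_ofNat, aeval_X]
    have e : sin (((k + 1 + 1 : ℕ) : ℝ) * θ) ^ 2 =
        2 * sin θ ^ 2 + (2 - 4 * sin θ ^ 2) * sin ((k + 1 : ℕ) * θ) ^ 2 - sin (k * θ) ^ 2 := by
      rw [show ((k + 1 + 1 : ℕ) : ℝ) * θ = (k + 1 : ℕ) * θ + θ by push_cast; ring,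
        show (k : ℝ) * θ = (k + 1 : ℕ) * θ - θ by push_cast; ring, sin_add, sin_sub]
      linear_combination (2 * sin ((k + 1 : ℕ) * θ) ^ 2) * sin_sq_add_cos_sq θ +
        (2 * sin θ ^ 2) * sin_sq_add_cos_sq ((k + 1 : ℕ) * θ)
    rw [show k.succ.succ = k + 1 + 1 from rfl, e, ih1, ih2]
    ring

lemma sin_odd_mul_eq (θ : ℝ) (r : ℕ) :
    sin ((2 * r + 1 : ℕ) * θ) = sin θ * aeval (4 * sin θ ^ 2) (chordOdd r) := by
  induction r using chordOdd.induct with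
  | case1 => simp [chordOdd]
  | case2 =>
    simp only [chordOdd, map_sub, map_ofNat, aeval_X]
    norm_num
    rw [sin_three_mul]
    ring
  | case3 r ih1 ih2 =>
    simp only [chordOdd, map_sub, map_mul, map_ofNat, aeval_X]
    have e : sin ((2 * (r + 2) + 1 : ℕ) * θ) =
        (2 - 4 * sin θ ^ 2) * sin ((2 * (r + 1) + 1 : ℕ) * θ) - sin ((2 * r + 1 : ℕ) * θ) := by
      rw [show ((2 * (r + 2) + 1 : ℕ) : ℝ) * θ = (2 * (r + 1) + 1 : ℕ) * θ + 2 * θ by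
          push_cast; ring,
        show ((2 * r + 1 : ℕ) : ℝ) * θ = (2 * (r + 1) + 1 : ℕ) * θ - 2 * θ by push_cast; ring,
        sin_add, sin_sub, cos_two_mul, cos_sq']
      ring
    rw [e, ih1, ih2]
    ring

lemma chordOdd_sq_add_sq (r : ℕ) :
    chordOdd (r + 1) ^ 2 + chordOdd r ^ 2 - (2 - X) * chordOdd r * chordOdd (r + 1) = 4 - X := by
  induction r with
  | zero => simp only [chordOdd]; ring
  | succ r ih =>
    rw [chordOdd]
    linear_combination ih

lemma chordSq_odd_and_even (r : ℕ) :
    chordSq (2 * r + 1) = chordOdd r ^ 2 ∧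
      chordSq (2 * r + 2) = chordOdd r * chordOdd (r + 1) + 1 := by
  induction r with
  | zero => simp [chordSq, chordOdd]; ring
  | succ r ih =>
    have h1 : chordSq (2 * (r + 1) + 1) = chordOdd (r + 1) ^ 2 := by
      rw [show 2 * (r + 1) + 1 = 2 * r + 1 + 2 by ring, chordSq, ih.1,
        show 2 * r + 1 + 1 = 2 * r + 2 by ring, ih.2]
      linear_combination -chordOdd_sq_add_sq r
    refine ⟨h1, ?_⟩
    rw [show 2 * (r + 1) + 2 = 2 * r + 2 + 2 by ring, chordSq, ih.2,
      show 2 * r + 2 + 1 = 2 * (r + 1) + 1 by ring, h1, chordOdd]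
    ring

lemma chordOdd_three : chordOdd 3 = 7 * (1 - 2 * X + X ^ 2) - X ^ 3 := by
  simp only [chordOdd]
  ring

lemma chordSq_seven : chordSq 7 = (7 * (1 - 2 * X + X ^ 2) - X ^ 3) ^ 2 := by
  rw [(chordSq_odd_and_even 3).1, chordOdd_three]

lemma chordSq_coeff_zero (k : ℕ) : (chordSq k).coeff 0 = k ^ 2 := by
  induction k using chordSq.induct with
  | case1 => simp [chordSq]
  | case2 => simp [chordSq]
  | case3 k ih1 ih2 =>
    simp only [chordSq, coeff_sub, coeff_add, mul_coeff_zero, coeff_ofNat_zero, coeff_X_zero,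
      ih1, ih2]
    push_cast
    ring

private lemma natDegree_step {p q s : ℤ[X]} {k : ℕ} (hp : p.natDegree ≤ k)
    (hq : q.natDegree ≤ k) (hs : s.natDegree ≤ k) :
    (s + (2 - X) * p - q).natDegree ≤ k + 1 ∧
      (s + (2 - X) * p - q).coeff (k + 1) = -p.coeff k := by
  have h2 : (2 - X : ℤ[X]).natDegree ≤ 1 := by
    rw [← C_ofNat]
    compute_degree
  constructor
  · refine (natDegree_sub_le _ _).trans (max_le ?_ (hq.trans (Nat.le_succ k)))
    refine natDegree_add_le_of_degree_le (hs.trans (Nat.le_succ k)) ?_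
    exact (natDegree_mul_le_of_le h2 hp).trans (by omega)
  · rw [coeff_sub, coeff_add, coeff_eq_zero_of_natDegree_lt (Nat.lt_succ_of_le hq),
      coeff_eq_zero_of_natDegree_lt (Nat.lt_succ_of_le hs), sub_mul, coeff_sub, coeff_X_mul,
      ← C_ofNat, coeff_C_mul, coeff_eq_zero_of_natDegree_lt (Nat.lt_succ_of_le hp)]
    simp

lemma chordSq_degree (k : ℕ) :
    (chordSq (k + 1)).natDegree ≤ k ∧ (chordSq (k + 1)).coeff k = (-1) ^ k := by
  induction k using Nat.twoStepInduction with
  | zero => simp [chordSq]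
  | one =>
    have h := natDegree_step (p := chordSq 1) (q := chordSq 0) (s := 2) (k := 0)
      (by simp [chordSq]) (by simp [chordSq]) (natDegree_ofNat 2).le
    refine ⟨h.1, h.2.trans ?_⟩
    simp [chordSq]
  | more k ih1 ih2 =>
    have h := natDegree_step (p := chordSq (k + 2)) (q := chordSq (k + 1)) (s := 2) (k := k + 1)
      ih2.1 (ih1.1.trans (Nat.le_succ k)) (by simp)
    refine ⟨h.1, h.2.trans ?_⟩
    rw [ih2.2]
    ring

lemma chordOdd_degree (r : ℕ) :
    (chordOdd r).natDegree ≤ r ∧ (chordOdd r).coeff r = (-1) ^ r := by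
  induction r using Nat.twoStepInduction with
  | zero => simp [chordOdd]
  | one =>
    rw [chordOdd, show (3 : ℤ[X]) = C 3 from rfl]
    refine ⟨by compute_degree, by simp [coeff_X]⟩
  | more r ih1 ih2 =>
    have h := natDegree_step (p := chordOdd (r + 1)) (q := chordOdd r) (s := 0) (k := r + 1)
      ih2.1 (ih1.1.trans (Nat.le_succ r)) (by simp)
    rw [zero_add] at h
    refine ⟨h.1, h.2.trans ?_⟩
    rw [ih2.2]
    ring

lemma map_aeval_chordSq {K Γ : Type*} [Field K] [LinearOrderedCommGroupWithZero Γ]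
    (v : Valuation K Γ) {x : K} (hx : 1 < v x) (k : ℕ) :
    v (aeval x (chordSq (k + 1))) = v x ^ k := by
  have h2 : v (2 : K) < v x := lt_of_le_of_lt (by simpa using v.map_natCast_le_one 2) hx
  have h2x : v (2 - x) = v x := v.map_sub_eq_of_lt_right h2
  have hstep (p q : K) (j : ℕ) (hp : v p = v x ^ j) (hq : v q ≤ v x ^ j) :
      v (2 + (2 - x) * p - q) = v x ^ (j + 1) := by
    have hlt : v x ^ j < v x ^ (j + 1) := pow_lt_pow_right₀ hx (Nat.lt_succ_self j)
    have h1 : v ((2 - x) * p) = v x ^ (j + 1) := by rw [map_mul, h2x, hp, pow_succ']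
    have h3 : v (2 + (2 - x) * p) = v x ^ (j + 1) := by
      rw [v.map_add_eq_of_lt_right, h1]
      rw [h1]
      exact h2.trans_le (le_self_pow₀ hx.le (Nat.succ_ne_zero j))
    rw [v.map_sub_eq_of_lt_left, h3]
    rw [h3]
    exact hq.trans_lt hlt
  induction k using Nat.twoStepInduction with
  | zero => simp [chordSq]
  | one =>
    have h := hstep 1 0 0 (by simp) (by simp)
    simp only [chordSq, map_sub, map_add, map_mul, map_ofNat, aeval_X, map_one, map_zero]
    exact h
  | more k ih1 ih2 =>
    rw [chordSq]
    simp only [map_sub, map_add, map_mul, map_ofNat, aeval_X]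
    exact hstep _ _ _ ih2 (by rw [ih1]; exact pow_le_pow_right₀ hx.le (Nat.le_succ k))

lemma le_norm_chordSq {w : ℂ} (hw : 6 ≤ ‖w‖) (k : ℕ) :
    ‖w‖ * (‖w‖ - 5) ^ k ≤ ‖w * aeval w (chordSq (k + 1))‖ := by
  set P : ℕ → ℂ := fun k => w * aeval w (chordSq k) with hP
  have hrec (k : ℕ) : P (k + 2) = 2 * w + (2 - w) * P (k + 1) - P k := by
    simp only [hP, chordSq, map_sub, map_add, map_mul, map_ofNat, aeval_X]
    ring
  have hlow (k : ℕ) : (‖w‖ - 2) * ‖P (k + 1)‖ - 2 * ‖w‖ - ‖P k‖ ≤ ‖P (k + 2)‖ := by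
    have h1 : (‖w‖ - 2) * ‖P (k + 1)‖ ≤ ‖(2 - w) * P (k + 1)‖ := by
      rw [norm_mul (2 - w)]
      have h2 : ‖w‖ - 2 ≤ ‖2 - w‖ := by
        simpa [norm_sub_rev] using norm_sub_norm_le w (2 : ℂ)
      exact mul_le_mul_of_nonneg_right h2 (norm_nonneg (P (k + 1)))
    have h2 : ‖(2 - w) * P (k + 1)‖ ≤ ‖P (k + 2)‖ + 2 * ‖w‖ + ‖P k‖ := by
      rw [show (2 - w) * P (k + 1) = P (k + 2) - 2 * w + P k by rw [hrec]; ring]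
      refine (norm_add_le _ _).trans ?_
      gcongr
      refine (norm_sub_le _ _).trans ?_
      simp
    linarith
  have key (k : ℕ) : ‖w‖ ≤ ‖P (k + 1)‖ ∧ (‖w‖ - 5) * ‖P (k + 1)‖ ≤ ‖P (k + 2)‖ := by
    induction k with
    | zero =>
      have h := hlow 0
      have h1 : P 1 = w := by simp [hP, chordSq]
      have h0 : P 0 = 0 := by simp [hP, chordSq]
      simp only [zero_add, h1, h0, norm_zero] at h ⊢
      exact ⟨le_rfl, by nlinarith⟩
    | succ k ih =>
      have hmono : ‖P (k + 1)‖ ≤ ‖P (k + 1 + 1)‖ := by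
        nlinarith [ih.1, ih.2, norm_nonneg (P (k + 1))]
      refine ⟨ih.1.trans hmono, ?_⟩
      have := hlow (k + 1)
      nlinarith [ih.1, ih.2]
  induction k with
  | zero => simpa [hP] using (key 0).1
  | succ k ih =>
    refine le_trans ?_ (key k).2
    rw [pow_succ, ← mul_assoc, mul_comm]
    gcongr
    linarith

end Chord

section SideRelation

open Polynomial

/-- The polynomial relation satisfied by `4u²` when `7` sides of length `a` and `m` sides of
length `7` close up to a cyclic polygon. -/
noncomputable def sideRelation (a : ℤ) (m : ℕ) : ℤ[X] :=
  C (a ^ 2) * (chordSq 7).comp (C (a ^ 2) * X) - 49 * (chordSq m).comp (C 49 * X)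

lemma aeval_sideRelation {K : Type*} [Field K] (a : ℤ) (m : ℕ) (x : K) :
    aeval x (sideRelation a m) =
      (a : K) ^ 2 * (7 * (1 - 2 * (a ^ 2 * x) + (a ^ 2 * x) ^ 2) - (a ^ 2 * x) ^ 3) ^ 2 -
        49 * aeval (49 * x) (chordSq m) := by
  simp [sideRelation, aeval_comp, chordSq_seven, map_ofNat (aeval x)]

variable {K Γ : Type*} [Field K] [LinearOrderedCommGroupWithZero Γ]
  {v : Valuation K Γ} {a : ℤ} {m : ℕ} {x : K}

private lemma map_mul_lt_one {y z : K} (hy : v y < 1) (hz : v z ≤ 1) : v (y * z) < 1 := by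
  rw [map_mul]
  exact (mul_le_of_le_one_right' hz).trans_lt hy

lemma pow_three_eq_of_sideRelation [CharZero K] (hv : v 7 < 1) (ha : ¬ (7 : ℤ) ∣ a)
    (ham : ¬ (7 : ℤ) ∣ a ^ 2 - m ^ 2) (hx : v x < 1) (h : aeval x (sideRelation a m) = 0) :
    v x ^ 3 = v 7 := by
  have hv' : v (7 : ℕ) < 1 := by exact_mod_cast hv
  have h7 : (7 : K) ≠ 0 := by norm_num
  have h7v : 0 < v 7 := zero_lt_iff.mpr ((v.ne_zero_iff).mpr h7)
  have hint (n : ℤ) : v (n : K) ≤ 1 := v.map_intCast_le_one n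
  have hva : v (a : K) = 1 := Valuation.map_intCast_eq_one (by norm_num) hv' (by exact_mod_cast ha)
  have ha2 : v ((a : K) ^ 2) = 1 := by rw [map_pow, hva, one_pow]
  have hW : v ((a : K) ^ 2 * x) = v x := by rw [map_mul, ha2, one_mul]
  set W : K := (a : K) ^ 2 * x with hWdef
  have hW1 : v W < 1 := hW ▸ hx
  set t : K := W - 2 with ht
  have ht1 : v t ≤ 1 := v.map_sub_le hW1.le (by simpa using hint 2)
  have hT1 : v (1 + W * t) ≤ 1 :=
    v.map_add_le v.map_one.le (map_mul_lt_one hW1 ht1).le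
  obtain ⟨y, hy, hQ⟩ : ∃ y : K, v y ≤ 1 ∧
      aeval (49 * x) (chordSq m) = (m : K) ^ 2 + 49 * x * y := by
    refine ⟨aeval (49 * x) (chordSq m).divX, v.map_aeval_le_one ?_ _, ?_⟩
    · rw [mul_comm]
      exact (map_mul_lt_one hx (by simpa using hint 49)).le
    · conv_lhs => rw [← divX_mul_X_add (chordSq m)]
      simp only [map_add, map_mul, aeval_X, aeval_C, chordSq_coeff_zero]
      simp only [algebraMap_int_eq, eq_intCast, Int.cast_pow, Int.cast_natCast]
      ring
  have h49 : v (49 * x * y) < 1 := by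
    rw [mul_comm (49 : K) x, mul_assoc]
    refine map_mul_lt_one hx ?_
    rw [map_mul]
    exact mul_le_one' (by simpa using hint 49) hy
  rw [aeval_sideRelation, hQ] at h
  rcases lt_trichotomy (v x ^ 3) (v 7) with hlt | heq | hgt
  · exfalso
    have hz : v (W ^ 3 / 7) < 1 := by
      rw [map_div₀, map_pow, hW]
      exact (div_lt_one₀ h7v).mpr hlt
    set z := W ^ 3 / 7 with hzdef
    have hz7 : W ^ 3 = 7 * z := by rw [hzdef]; field_simp
    have key : ((a ^ 2 - m ^ 2 : ℤ) : K) =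
        49 * x * y - W * (t * (2 + W * t) * a ^ 2) + z * ((2 * (1 + W * t) - z) * a ^ 2) := by
      push_cast
      have h49' : (49 : K) ≠ 0 := by norm_num
      refine mul_left_cancel₀ h49' ?_
      rw [hz7] at h
      linear_combination h
    have h1 : v ((a ^ 2 - m ^ 2 : ℤ) : K) = 1 :=
      Valuation.map_intCast_eq_one (by norm_num) hv' (by exact_mod_cast ham)
    rw [key] at h1
    refine (v.map_add_lt (v.map_sub_lt h49 (map_mul_lt_one hW1 ?_))
      (map_mul_lt_one hz ?_)).ne h1
    · rw [map_mul, map_mul, ha2, mul_one]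
      exact mul_le_one' ht1 (v.map_add_le (by simpa using hint 2) (map_mul_lt_one hW1 ht1).le)
    · rw [map_mul, ha2, mul_one]
      refine v.map_sub_le ?_ hz.le
      rw [map_mul]
      exact mul_le_one' (by simpa using hint 2) hT1
  · exact heq
  · exfalso
    have hW0 : W ^ 3 ≠ 0 := by
      rw [← v.ne_zero_iff, map_pow, hW]
      exact (h7v.trans hgt).ne'
    have hz : v (7 / W ^ 3) < 1 := by
      rw [map_div₀, map_pow, hW]
      exact (div_lt_one₀ (h7v.trans hgt)).mpr hgt
    set z := 7 / W ^ 3 with hzdef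
    have hz7 : (7 : K) = z * W ^ 3 := by rw [hzdef, div_mul_cancel₀ _ hW0]
    have key : (a : K) ^ 2 = z * (z * (m ^ 2 + 49 * x * y) +
        (2 * (1 + W * t) - z * (1 + W * t) ^ 2) * a ^ 2) := by
      refine mul_left_cancel₀ (pow_ne_zero 2 hW0) ?_
      have h49' : (49 : K) = z ^ 2 * W ^ 6 := by linear_combination (7 + z * W ^ 3) * hz7
      have h' : (a : K) ^ 2 * (z * W ^ 3 * (1 - 2 * W + W ^ 2) - W ^ 3) ^ 2 =
          z ^ 2 * W ^ 6 * (m ^ 2 + 49 * x * y) := by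
        rw [← hz7]
        linear_combination h + (m ^ 2 + 49 * x * y) * h49'
      linear_combination h'
    refine (lt_of_eq_of_lt (congrArg v key) (map_mul_lt_one hz ?_)).ne ha2
    refine v.map_add_le ?_ ?_
    · rw [map_mul]
      refine mul_le_one' hz.le (v.map_add_le ?_ h49.le)
      simpa using pow_le_one' (hint m) 2
    · rw [map_mul, ha2, mul_one]
      refine v.map_sub_le ?_ ?_ <;> rw [map_mul]
      · exact mul_le_one' (by simpa using hint 2) hT1
      · rw [map_pow]
        exact mul_le_one' hz.le (pow_le_one' hT1 2)

lemma pow_seven_eq_of_sideRelation (hv : v 7 < 1) (ha : ¬ (7 : ℤ) ∣ a) (hm : 0 < m)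
    (hx : 1 < v x) (h : aeval x (sideRelation a m) = 0) :
    v x ^ 7 = v 7 ^ (2 * m) * v x ^ m := by
  have hv' : v (7 : ℕ) < 1 := by exact_mod_cast hv
  have hva : v (a : K) = 1 := Valuation.map_intCast_eq_one (by norm_num) hv' (by exact_mod_cast ha)
  have ha2 : v ((a : K) ^ 2) = 1 := by rw [map_pow, hva, one_pow]
  have hv49 : v 49 = v 7 ^ 2 := by rw [← map_pow]; norm_num
  have hW : v ((a : K) ^ 2 * x) = v x := by rw [map_mul, ha2, one_mul]
  obtain ⟨k, rfl⟩ : ∃ k, m = k + 1 := ⟨m - 1, by omega⟩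
  have hA : v ((a : K) ^ 2 * aeval ((a : K) ^ 2 * x) (chordSq 7)) = v x ^ 6 := by
    rw [map_mul, ha2, one_mul, map_aeval_chordSq v (by rwa [hW]), hW]
  have hE : (a : K) ^ 2 * aeval ((a : K) ^ 2 * x) (chordSq 7) =
      49 * aeval (49 * x) (chordSq (k + 1)) := by
    rw [aeval_sideRelation] at h
    simp only [chordSq_seven, map_sub, map_pow, map_mul, map_add, map_one, map_ofNat, aeval_X]
    linear_combination h
  rw [hE, map_mul] at hA
  have hlarge : 1 < v (49 * x) := by
    by_contra hle
    have h1 := v.map_aeval_le_one (not_lt.mp hle) (chordSq (k + 1))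
    have h2 : v (49 : K) ≤ 1 := by rw [hv49]; exact pow_le_one' hv.le 2
    exact ((mul_le_one' h2 h1).trans_lt (one_lt_pow₀ hx (n := 6) (by norm_num))).ne hA
  rw [map_aeval_chordSq v hlarge, map_mul, hv49] at hA
  rw [pow_succ (v x) 6, ← hA, mul_pow, ← pow_mul, mul_add, pow_add, pow_succ (v x) k]
  ac_rfl

lemma seven_lt_of_sideRelation (hv : v 7 < 1) (ha : ¬ (7 : ℤ) ∣ a) (hm : 0 < m)
    (hx : 1 < v x) (h : aeval x (sideRelation a m) = 0) : 7 < m := by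
  by_contra hle
  have h1 := pow_seven_eq_of_sideRelation hv ha hm hx h
  have h2 : v x ^ m ≤ v x ^ 7 := pow_le_pow_right₀ hx.le (not_lt.mp hle)
  have h3 : 0 < v x ^ m := zero_lt_iff.mpr (pow_ne_zero _ (zero_lt_one.trans hx).ne')
  have h4 : v 7 ^ (2 * m) < 1 := pow_lt_one₀ zero_le hv (by omega)
  have h5 : v 7 ^ (2 * m) * v x ^ m < v x ^ m := mul_lt_of_lt_one_left h3 h4
  exact (h5.trans_le h2).ne' h1

lemma norm_lt_one_of_sideRelation (ha : |a| ≤ 2) (hm : 8 ≤ m) {x : ℂ}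
    (h : aeval x (sideRelation a m) = 0) : ‖x‖ < 1 := by
  by_contra hx
  rw [not_lt] at hx
  obtain ⟨k, rfl⟩ : ∃ k, m = k + 1 := ⟨m - 1, by omega⟩
  set r := ‖x‖ with hr
  have hw : ‖(49 : ℂ) * x‖ = 49 * r := by simp [hr]
  have hy : ‖(a : ℂ) ^ 2 * x‖ ≤ 4 * r := by
    rw [norm_mul, norm_pow, Complex.norm_intCast]
    have h2 : |(a : ℝ)| ≤ 2 := by exact_mod_cast ha
    have h0 := abs_nonneg (a : ℝ)
    exact mul_le_mul_of_nonneg_right (by nlinarith) (norm_nonneg x)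
  set y := (a : ℂ) ^ 2 * x with hydef
  have hlow : 49 * r * (44 * r) ^ 7 ≤ ‖49 * x * aeval (49 * x) (chordSq (k + 1))‖ := by
    refine le_trans ?_ (le_norm_chordSq (by rw [hw]; linarith) k)
    rw [hw]
    have h1 : 1 ≤ 49 * r - 5 := by linarith
    calc 49 * r * (44 * r) ^ 7 ≤ 49 * r * (49 * r - 5) ^ 7 := by gcongr; linarith
      _ ≤ 49 * r * (49 * r - 5) ^ k := by gcongr; omega
  have hB : ‖7 * (1 - 2 * y + y ^ 2) - y ^ 3‖ ≤ 256 * r ^ 3 := by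
    have h1 : ‖7 * (1 - 2 * y + y ^ 2) - y ^ 3‖ ≤ 7 * (1 + 2 * ‖y‖ + ‖y‖ ^ 2) + ‖y‖ ^ 3 := by
      refine (norm_sub_le _ _).trans ?_
      rw [norm_mul, norm_pow]
      gcongr
      · simp
      · refine (norm_add_le _ _).trans ?_
        rw [norm_pow]
        gcongr
        refine (norm_sub_le _ _).trans ?_
        simp
    have h2 : 7 * (1 + 2 * ‖y‖ + ‖y‖ ^ 2) + ‖y‖ ^ 3 ≤
        7 * (1 + 2 * (4 * r) + (4 * r) ^ 2) + (4 * r) ^ 3 := by gcongr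
    have h3 : r ≤ r ^ 3 := le_self_pow₀ hx (by norm_num)
    have h4 : r ^ 2 ≤ r ^ 3 := pow_le_pow_right₀ hx (by norm_num)
    nlinarith
  have hup : ‖y * (7 * (1 - 2 * y + y ^ 2) - y ^ 3) ^ 2‖ ≤ 4 * r * (256 * r ^ 3) ^ 2 := by
    rw [norm_mul, norm_pow]
    gcongr
  have heq : y * (7 * (1 - 2 * y + y ^ 2) - y ^ 3) ^ 2 =
      49 * x * aeval (49 * x) (chordSq (k + 1)) := by
    rw [aeval_sideRelation] at h
    rw [hydef]
    linear_combination x * h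
  rw [heq] at hup
  have h7 : r ^ 7 ≤ r ^ 8 := pow_le_pow_right₀ hx (by norm_num)
  have h70 : 1 ≤ r ^ 7 := one_le_pow₀ hx
  nlinarith [hlow.trans hup]

end SideRelation

section Irreducibility

open Polynomial

/-- A real root of a nonzero integer polynomial `F` is a root of a primitive irreducible factor of
`F` generating its ideal of relations. -/
lemma exists_prime_dvd_generator {F : ℤ[X]} (hF : F ≠ 0) {x : ℝ} (hx : aeval x F = 0) :
    ∃ G : ℤ[X], Prime G ∧ G ∣ F ∧ 0 < G.natDegree ∧ aeval x G = 0 ∧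
      ∀ h : ℤ[X], aeval x h = 0 → G ∣ h := by
  have hI : (RingHom.ker (aeval (R := ℤ) x)).IsPrime := RingHom.ker_isPrime _
  obtain ⟨G, hGI, hG⟩ := hI.exists_mem_prime_of_ne_bot
    (fun h => hF (by rwa [← Ideal.mem_bot, ← h, RingHom.mem_ker]))
  have hGx : aeval x G = 0 := hGI
  have hdeg : G.natDegree ≠ 0 := by
    intro h0
    obtain ⟨c, rfl⟩ := natDegree_eq_zero.mp h0
    refine hG.ne_zero ?_
    simpa using hGx
  have hprim : G.IsPrimitive := hG.irreducible.isPrimitive hdeg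
  have hmap (h : ℤ[X]) : aeval x (h.map (Int.castRingHom ℚ)) = aeval x h :=
    aeval_map_algebraMap ℚ x h
  have hgen (h : ℤ[X]) (hh : aeval x h = 0) : G ∣ h := by
    rw [IsPrimitive.Int.dvd_iff_map_cast_dvd_map_cast G h hprim]
    have hirr := (IsPrimitive.Int.irreducible_iff_irreducible_map_cast hprim).mp hG.irreducible
    have h1 : minpoly ℚ x ∣ G.map (Int.castRingHom ℚ) := minpoly.dvd ℚ x (by rw [hmap, hGx])
    have hx' : IsIntegral ℚ x := by
      refine IsAlgebraic.isIntegral ⟨_, hirr.ne_zero, by rw [hmap, hGx]⟩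
    have h2 := (minpoly.irreducible hx').associated_of_dvd hirr h1
    exact h2.symm.dvd.trans (minpoly.dvd ℚ x (by rw [hmap, hh]))
  exact ⟨G, hG, hgen F hx, Nat.pos_of_ne_zero hdeg, hGx, hgen⟩

/-- An integer polynomial with leading coefficient `±1` and all complex roots of modulus less than
`1` has constant term zero. -/
lemma coeff_zero_eq_zero_of_norm_roots_lt_one {H : ℤ[X]} (hlead : IsUnit H.leadingCoeff)
    (hdeg : 0 < H.natDegree) (hroots : ∀ z : ℂ, aeval z H = 0 → ‖z‖ < 1) : H.coeff 0 = 0 := by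
  set f := H.map (Int.castRingHom ℂ) with hf
  have hinj : Function.Injective (Int.castRingHom ℂ) := Int.cast_injective
  have hH0 : H ≠ 0 := by rintro rfl; simp at hdeg
  have hf0 : f ≠ 0 := (Polynomial.map_ne_zero_iff hinj).mpr hH0
  have hsplit : f.Splits := IsAlgClosed.splits f
  have h1 := hsplit.coeff_zero_eq_leadingCoeff_mul_prod_roots
  have hroot (z : ℂ) (hz : z ∈ f.roots) : ‖z‖ < 1 := by
    refine hroots z ?_
    rw [mem_roots hf0, IsRoot, hf, eval_map] at hz
    exact hz
  have hcard : f.roots ≠ 0 := by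
    intro h0
    have := hsplit.natDegree_eq_card_roots
    rw [h0, hf, natDegree_map_eq_of_injective hinj] at this
    simp only [Multiset.card_zero] at this
    omega
  have hprod (s : Multiset ℂ) (hs : ∀ z ∈ s, ‖z‖ < 1) : ‖s.prod‖ ≤ 1 ∧ (s ≠ 0 → ‖s.prod‖ < 1) := by
    induction s using Multiset.induction with
    | empty => simp
    | cons z s ih =>
      have hz := hs z (Multiset.mem_cons_self z s)
      have hs' := (ih fun y hy => hs y (Multiset.mem_cons_of_mem hy)).1
      have : ‖(z ::ₘ s).prod‖ < 1 := by
        rw [Multiset.prod_cons, norm_mul]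
        exact mul_lt_one_of_nonneg_of_lt_one_left (norm_nonneg z) hz hs'
      exact ⟨this.le, fun _ => this⟩
  have hlt : ‖f.coeff 0‖ < 1 := by
    have hl : ‖f.leadingCoeff‖ = 1 := by
      rw [hf, leadingCoeff_map_of_injective hinj]
      rcases Int.isUnit_iff.mp hlead with h | h <;> simp [h]
    rw [h1, norm_mul, norm_mul, hl, norm_pow, norm_neg, norm_one, one_pow, one_mul, one_mul]
    exact (hprod _ hroot).2 hcard
  rw [hf, coeff_map, eq_intCast, Complex.norm_intCast] at hlt
  exact Int.abs_lt_one_iff.mp (by exact_mod_cast hlt)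

/-- Cutting the lower part `w X ^ c` modulo a prime `p` out of a factorization in which the first
factor has constant term prime to `p`. -/
lemma dvd_coeff_and_not_dvd_coeff_of_mul_eq {p : ℕ} (hp : p.Prime) {G H J : ℤ[X]} {w : ℤ} {c : ℕ}
    (hw : ¬ (p : ℤ) ∣ w) (hGH : G * H = C w * X ^ c + C (p : ℤ) * J)
    (hG : ¬ (p : ℤ) ∣ G.coeff 0) :
    (∀ i, 0 < i → (p : ℤ) ∣ G.coeff i) ∧ ¬ (p : ℤ) ∣ H.coeff c ∧
      ∀ i, c < i → (p : ℤ) ∣ H.coeff i := by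
  have : Fact p.Prime := ⟨hp⟩
  let φ := Int.castRingHom (ZMod p)
  have hw' : (w : ZMod p) ≠ 0 := by rwa [Ne, ZMod.intCast_zmod_eq_zero_iff_dvd]
  have hmul : G.map φ * H.map φ = C (w : ZMod p) * X ^ c := by
    rw [← Polynomial.map_mul, hGH]
    simp [φ]
  have hG0 : (G.map φ).coeff 0 ≠ 0 := by
    rwa [coeff_map, eq_intCast, Ne, ZMod.intCast_zmod_eq_zero_iff_dvd]
  have hX : ¬ X ∣ G.map φ := by rwa [X_dvd_iff]
  obtain ⟨K, hK⟩ : X ^ c ∣ H.map φ :=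
    (prime_X.pow_dvd_of_dvd_mul_left c hX (hmul ▸ Dvd.intro_left _ rfl))
  have hGK : G.map φ * K = C (w : ZMod p) := by
    refine mul_left_cancel₀ (pow_ne_zero c (X_ne_zero (R := ZMod p))) ?_
    rw [hK] at hmul
    linear_combination hmul
  have hunit : IsUnit (G.map φ * K) := by
    rw [hGK]
    exact isUnit_C.mpr (isUnit_iff_ne_zero.mpr hw')
  have hGu := natDegree_eq_zero_of_isUnit (isUnit_of_mul_isUnit_left hunit)
  have hKu := isUnit_of_mul_isUnit_right hunit
  obtain ⟨k, hk, hKk⟩ := Polynomial.isUnit_iff.mp hKu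
  rw [← hKk] at hK
  have hcoeff (i : ℕ) : ((H.coeff i : ℤ) : ZMod p) = if i = c then k else 0 := by
    have := congrArg (fun q => coeff q i) hK
    simpa [φ, coeff_X_pow] using this
  refine ⟨fun i hi => ?_, fun h => ?_, fun i hi => ?_⟩
  · rw [← ZMod.intCast_zmod_eq_zero_iff_dvd]
    have : (G.map φ).coeff i = 0 := coeff_eq_zero_of_natDegree_lt (by omega)
    simpa [φ] using this
  · rw [← ZMod.intCast_zmod_eq_zero_iff_dvd, hcoeff, if_pos rfl] at h
    exact hk.ne_zero h
  · rw [← ZMod.intCast_zmod_eq_zero_iff_dvd, hcoeff, if_neg hi.ne']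

end Irreducibility

section NotConstructible

open Polynomial

lemma sideRelation_coeff_zero (a : ℤ) (m : ℕ) :
    (sideRelation a m).coeff 0 = 49 * (a ^ 2 - m ^ 2) := by
  simp only [sideRelation, coeff_sub, coeff_C_mul, coeff_ofNat_mul, comp_C_mul_X_coeff,
    chordSq_coeff_zero, pow_zero]
  push_cast
  ring

/-- The product of the roots of an integer polynomial all of whose complex roots have the same
value, up to a power. -/
lemma map_leadingCoeff_pow_eq {Γ : Type*} [LinearOrderedCommGroupWithZero Γ] {v : Valuation ℂ Γ}
    {G : ℤ[X]} (hG : G ≠ 0) {d : ℕ} {γ : Γ} (h0 : v (G.coeff 0 : ℂ) = 1)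
    (hroots : ∀ z : ℂ, aeval z G = 0 → v z ^ d * γ = 1) :
    v (G.leadingCoeff : ℂ) ^ d = γ ^ G.natDegree := by
  set f := G.map (Int.castRingHom ℂ) with hf
  have hinj : Function.Injective (Int.castRingHom ℂ) := Int.cast_injective
  have hf0 : f ≠ 0 := (Polynomial.map_ne_zero_iff hinj).mpr hG
  have hsplit : f.Splits := IsAlgClosed.splits f
  have h1 := hsplit.coeff_zero_eq_leadingCoeff_mul_prod_roots
  have hroot (z : ℂ) (hz : z ∈ f.roots) : v z ^ d * γ = 1 := by
    refine hroots z ?_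
    rw [mem_roots hf0, IsRoot, hf, eval_map] at hz
    exact hz
  have hprod (s : Multiset ℂ) (hs : ∀ z ∈ s, v z ^ d * γ = 1) :
      v s.prod ^ d * γ ^ s.card = 1 := by
    induction s using Multiset.induction with
    | empty => simp
    | cons z s ih =>
      rw [Multiset.prod_cons, Multiset.card_cons, map_mul, mul_pow, pow_succ,
        mul_comm (γ ^ _) γ]
      have hz := hs z (Multiset.mem_cons_self z s)
      have hs' := ih fun y hy => hs y (Multiset.mem_cons_of_mem hy)
      calc v z ^ d * v s.prod ^ d * (γ * γ ^ s.card)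
          = (v z ^ d * γ) * (v s.prod ^ d * γ ^ s.card) := mul_mul_mul_comm _ _ _ _
        _ = 1 := by rw [hz, hs', one_mul]
  have h2 := hprod _ hroot
  rw [← hsplit.natDegree_eq_card_roots, hf, natDegree_map_eq_of_injective hinj, ← hf] at h2
  have h3 : v (G.leadingCoeff : ℂ) * v f.roots.prod = 1 := by
    rw [hf, leadingCoeff_map_of_injective hinj, coeff_map, ← hf] at h1
    have h4 := congrArg v h1
    simp only [eq_intCast, h0, map_mul, map_pow, Valuation.map_neg, map_one, one_pow, one_mul] at h4
    exact h4.symm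
  have h4 : v (G.leadingCoeff : ℂ) ^ d * v f.roots.prod ^ d = 1 := by
    rw [← mul_pow, h3, one_pow]
  have h5 : v f.roots.prod ^ d ≠ 0 := right_ne_zero_of_mul_eq_one h4
  refine mul_right_cancel₀ h5 ?_
  rw [h4, mul_comm, h2]

lemma notMem_Qclo_of_sideRelation {a w : ℤ} {m c : ℕ} {F J : ℤ[X]} (ha7 : ¬ (7 : ℤ) ∣ a)
    (ha2 : |a| ≤ 2) (hm : 0 < m) (ham : ¬ (7 : ℤ) ∣ a ^ 2 - m ^ 2) (hFE : F ∣ sideRelation a m)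
    (hc : 0 < c) (hw : ¬ (7 : ℤ) ∣ w) (hF : F = C w * X ^ c + C 7 * J)
    (hdeg : 8 ≤ m → ∃ L N, F.natDegree = c + L ∧ F.leadingCoeff ∣ 7 ^ N ∧
      ∀ s k, 0 < k → (m - 7) * s = 2 * m * k → L ≤ k)
    {x : ℝ} (hx : aeval x F = 0) : x ∉ Qclo ⊥ := by
  have hp : Nat.Prime 7 := by norm_num
  have hE0 : (sideRelation a m).coeff 0 ≠ 0 := by
    rw [sideRelation_coeff_zero]
    exact fun h => ham ⟨0, by linarith⟩
  have hrel {K : Type} [Field K] {P : ℤ[X]} (hP : P ∣ F) {z : K} (hz : aeval z P = 0) :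
      aeval z (sideRelation a m) = 0 := by
    obtain ⟨Q, hQ⟩ := hP.trans hFE
    rw [hQ, map_mul, hz, zero_mul]
  have hF0 : F ≠ 0 := by
    rintro rfl
    exact hE0 (by rw [zero_dvd_iff.mp hFE, coeff_zero])
  obtain ⟨G, hG, hGF, hGdeg, hGx, hgen⟩ := exists_prime_dvd_generator hF0 hx
  by_cases hG0 : (7 : ℤ) ∣ G.coeff 0
  · obtain ⟨B, hB7, hBx⟩ := exists_valuationSubring_lt_one (p := 7) x fun h hh h7 => by
      obtain ⟨Q, rfl⟩ := hgen h hh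
      rw [mul_coeff_zero] at h7
      have h1 := dvd_sub (hG0.mul_right (Q.coeff 0)) h7
      norm_num at h1
    have hB7' : B.valuation 7 < 1 := by exact_mod_cast hB7
    refine notMem_Qclo_of_pow_three (v := B.valuation) hp (by norm_num) hB7 ?_
    rw [pow_three_eq_of_sideRelation hB7' ha7 ham hBx (hrel hGF hGx), Nat.cast_ofNat]
  exfalso
  obtain ⟨B, hB7⟩ := exists_valuationSubring_prime_lt_one ℂ (p := 7) (by norm_num)
  set v := B.valuation
  have hB7' : v 7 < 1 := by exact_mod_cast hB7
  have hv70 : 0 < v 7 := zero_lt_iff.mpr ((v.ne_zero_iff).mpr (by norm_num))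
  obtain ⟨H, hGH⟩ := hGF
  obtain ⟨hGi, hHc, hHi⟩ := dvd_coeff_and_not_dvd_coeff_of_mul_eq hp hw (hGH ▸ hF) hG0
  have hv0 : v (G.coeff 0 : ℂ) = 1 := Valuation.map_intCast_eq_one hp hB7 hG0
  have hlarge {z : ℂ} (hz : aeval z G = 0) : 1 < v z := by
    by_contra hle
    rw [not_lt] at hle
    have h1 : (G.coeff 0 : ℂ) = -∑ i ∈ Finset.range G.natDegree, G.coeff (i + 1) * z ^ (i + 1) := by
      rw [aeval_eq_sum_range, Finset.sum_range_succ'] at hz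
      simp only [zsmul_eq_mul, pow_zero, mul_one] at hz
      linear_combination hz
    refine (lt_of_eq_of_lt ((congrArg v h1).trans (v.map_neg _)) ?_).ne hv0
    refine v.map_sum_lt one_ne_zero fun i _ => ?_
    rw [map_mul, map_pow]
    exact (mul_le_of_le_one_right' (pow_le_one' hle _)).trans_lt
      (Valuation.map_intCast_lt_one hB7 (hGi _ i.succ_pos))
  have hroot {z : ℂ} (hz : aeval z G = 0) := hrel ⟨H, hGH⟩ hz
  obtain ⟨z, hz⟩ : ∃ z : ℂ, aeval z G = 0 :=
    IsAlgClosed.exists_aeval_eq_zero_of_injective ℂ Int.cast_injective G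
      (natDegree_pos_iff_degree_pos.mp hGdeg).ne'
  have hm8 : 8 ≤ m := seven_lt_of_sideRelation hB7' ha7 hm (hlarge hz) (hroot hz)
  obtain ⟨L, N, hFL, hFN, hL⟩ := hdeg hm8
  have hH0 : H ≠ 0 := by
    rintro rfl
    simp at hHc
  have hvG := map_leadingCoeff_pow_eq hG.ne_zero (d := m - 7) (γ := v 7 ^ (2 * m)) hv0
    fun z hz => by
      have h7 := pow_seven_eq_of_sideRelation hB7' ha7 hm (hlarge hz) (hroot hz)
      have hz7 : v z ^ 7 ≠ 0 := pow_ne_zero _ (zero_lt_one.trans (hlarge hz)).ne'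
      refine mul_left_cancel₀ hz7 ?_
      rw [← mul_assoc, ← pow_add, mul_one, mul_comm, show 7 + (m - 7) = m by omega, ← h7]
  rw [hGH, leadingCoeff_mul] at hFN
  have hGN : G.leadingCoeff.natAbs ∣ 7 ^ N := by
    simpa [Int.natAbs_pow] using Int.natAbs_dvd_natAbs.mpr ((Dvd.intro _ rfl).trans hFN)
  have hHN : H.leadingCoeff.natAbs ∣ 7 ^ N := by
    simpa [Int.natAbs_pow] using Int.natAbs_dvd_natAbs.mpr ((Dvd.intro_left _ rfl).trans hFN)
  obtain ⟨s, -, hs⟩ := (Nat.dvd_prime_pow hp).mp hGN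
  have hvs : v (G.leadingCoeff : ℂ) = v 7 ^ s := by
    rcases Int.natAbs_eq G.leadingCoeff with h | h <;> rw [h, hs] <;> simp
  rw [hvs, ← pow_mul, ← pow_mul] at hvG
  have hsk := pow_right_injective₀ hv70 hB7'.ne hvG
  have hLk := hL s G.natDegree hGdeg (by rw [← hsk, mul_comm])
  rw [hGH, natDegree_mul hG.ne_zero hH0] at hFL
  have hHdeg : H.natDegree = c :=
    le_antisymm (by omega) (le_natDegree_of_ne_zero fun h => hHc (h ▸ dvd_zero _))
  have hHlead : IsUnit H.leadingCoeff := by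
    obtain ⟨t, -, ht⟩ := (Nat.dvd_prime_pow hp).mp hHN
    rw [leadingCoeff, hHdeg] at ht ⊢
    rcases t.eq_zero_or_pos with rfl | htpos
    · exact Int.isUnit_iff_natAbs_eq.mpr (by simpa using ht)
    · refine absurd (Int.natCast_dvd.mpr ?_) hHc
      rw [ht]
      exact dvd_pow_self 7 htpos.ne'
  have hHzero := coeff_zero_eq_zero_of_norm_roots_lt_one hHlead (by omega) fun z hz =>
    norm_lt_one_of_sideRelation ha2 hm8 (hrel ⟨G, by rw [hGH, mul_comm]⟩ hz)
  obtain ⟨Q, hQ⟩ := hFE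
  refine hE0 ?_
  rw [hQ, hGH, mul_coeff_zero, mul_coeff_zero, hHzero, mul_zero, zero_mul]

end NotConstructible

section Polygon

open Polynomial

lemma natDegree_and_leadingCoeff_dvd {P Q : ℤ[X]} {d : ℕ} (i : ℕ) (hP : P.natDegree < d)
    (hQ : Q.natDegree ≤ d) (hQd : Q.coeff d = (-1) ^ d) :
    (P - C (7 ^ i) * Q.comp (C 49 * X)).natDegree = d ∧
      (P - C (7 ^ i) * Q.comp (C 49 * X)).leadingCoeff ∣ 7 ^ (i + 2 * d) := by
  have hcoeff : (P - C (7 ^ i) * Q.comp (C 49 * X)).coeff d = -(-1) ^ d * 7 ^ (i + 2 * d) := by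
    rw [coeff_sub, coeff_eq_zero_of_natDegree_lt hP, coeff_C_mul, comp_C_mul_X_coeff, hQd, pow_add,
      pow_mul]
    ring
  have hdeg : (P - C (7 ^ i) * Q.comp (C 49 * X)).natDegree = d := by
    refine natDegree_eq_of_le_of_coeff_ne_zero ?_ (by rw [hcoeff]; simp)
    refine natDegree_sub_le_of_le hP.le ((natDegree_C_mul_le _ _).trans ?_) |>.trans (max_self d).le
    refine natDegree_comp_le.trans ?_
    simpa using Nat.mul_le_mul hQ ((natDegree_C_mul_le (49 : ℤ) X).trans natDegree_X_le)
  refine ⟨hdeg, ?_⟩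
  rw [leadingCoeff, hdeg, hcoeff]
  rcases neg_one_pow_eq_or ℤ d with h | h <;> simp [h]

lemma natDegree_C_mul_comp_le (b e : ℤ) {P : ℤ[X]} {d : ℕ} (hP : P.natDegree ≤ d) :
    (C b * P.comp (C e * X)).natDegree ≤ d := by
  refine (natDegree_C_mul_le _ _).trans (natDegree_comp_le.trans ?_)
  simpa using Nat.mul_le_mul hP ((natDegree_C_mul_le e X).trans natDegree_X_le)

lemma coprime_sub_seven {m : ℕ} (hm : 8 ≤ m) (h7 : ¬ 7 ∣ m) : Nat.Coprime (m - 7) m := by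
  have h : Nat.Coprime 7 m := (Nat.Prime.coprime_iff_not_dvd (by norm_num)).mpr h7
  exact (Nat.coprime_self_sub_left (by omega)).mpr h

variable {α β u : ℝ} {a m : ℕ}

lemma notMem_Qclo_of_even (hu : 0 < u) (hα : sin α = a * u) (hβ : sin β = 7 * u)
    (hαβ : 7 * α + m * β = π) (ha : ¬ 7 ∣ a) (ha2 : a ≤ 2) (hm : 0 < m) (hm7 : ¬ 7 ∣ m)
    (ham : ¬ (7 : ℤ) ∣ a ^ 2 - m ^ 2) (hm2 : Even m) : u ∉ Qclo ⊥ := by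
  suffices h : 4 * u ^ 2 ∉ Qclo ⊥ from fun hu => h (mul_mem (ofNat_mem _ 4) (pow_mem hu 2))
  have ha7 : ¬ (7 : ℤ) ∣ a := by exact_mod_cast ha
  set A : ℤ[X] := C ((a : ℤ) ^ 2) * X with hA
  refine notMem_Qclo_of_sideRelation (a := a) (w := (a : ℤ) ^ 14) (c := 6)
    (J := C ((a : ℤ) ^ 2) * (7 * (1 - 2 * A + A ^ 2) ^ 2 - 2 * (1 - 2 * A + A ^ 2) * A ^ 3) -
      7 * (chordSq m).comp (C 49 * X)) ha7 (by rw [Nat.abs_cast]; exact_mod_cast ha2) hm ham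
    dvd_rfl (by norm_num) (fun h => ha7 (Int.prime_ofNat_iff.mpr (by norm_num) |>.dvd_of_dvd_pow h))
    ?_ ?_ ?_
  · simp only [sideRelation, chordSq_seven, ← hA, sub_comp, pow_comp, mul_comp, add_comp, one_comp,
      ofNat_comp, X_comp]
    rw [show (C ((a : ℤ) ^ 14) * X ^ 6 : ℤ[X]) = C ((a : ℤ) ^ 2) * A ^ 6 by
      rw [hA]; simp only [map_pow]; ring, show (C 7 : ℤ[X]) = 7 from rfl]
    ring
  · intro hm8
    obtain ⟨k, rfl⟩ : ∃ k, m = k + 1 := ⟨m - 1, by omega⟩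
    obtain ⟨h1, h2⟩ := natDegree_and_leadingCoeff_dvd 2 (d := k)
      (P := C ((a : ℤ) ^ 2) * (chordSq 7).comp A)
      ((natDegree_C_mul_comp_le _ _ (chordSq_degree 6).1).trans_lt (by omega))
      (chordSq_degree k).1 (chordSq_degree k).2
    refine ⟨k + 1 - 7, 2 + 2 * k, h1.trans (by omega), h2, fun s l hl h => ?_⟩
    have hodd : Nat.Coprime (k + 1 - 7) 2 := by
      rw [Nat.coprime_two_right, ← Nat.not_even_iff_odd, Nat.even_sub (by omega)]
      simp [hm2, show ¬ Even 7 by decide]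
    exact Nat.le_of_dvd hl ((hodd.mul_right (coprime_sub_seven hm8 hm7)).dvd_of_dvd_mul_left
      (Dvd.intro s h))
  · have h7 := sin_mul_sq_eq α 7
    have hmβ := sin_mul_sq_eq β m
    rw [show ((7 : ℕ) : ℝ) * α = π - m * β by push_cast; linarith, sin_pi_sub, hmβ, hα, hβ,
      chordSq_seven] at h7
    have hu2 : u ^ 2 ≠ 0 := pow_ne_zero 2 hu.ne'
    rw [aeval_sideRelation, show 49 * (4 * u ^ 2) = 4 * (7 * u) ^ 2 by ring]
    refine mul_left_cancel₀ hu2 ?_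
    simp only [map_sub, map_pow, map_mul, map_add, map_one, map_ofNat, aeval_X] at h7
    push_cast
    linear_combination -h7

lemma notMem_Qclo_of_odd (hu : 0 < u) (hα : sin α = a * u) (hβ : sin β = 7 * u)
    (hαβ : 7 * α + m * β = π) (ha : ¬ 7 ∣ a) (ha2 : a ≤ 2) (hm7 : ¬ 7 ∣ m)
    (ham : ¬ (7 : ℤ) ∣ a ^ 2 - m ^ 2) (hm2 : Odd m) : u ∉ Qclo ⊥ := by
  suffices h : 4 * u ^ 2 ∉ Qclo ⊥ from fun hu => h (mul_mem (ofNat_mem _ 4) (pow_mem hu 2))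
  have ha7 : ¬ (7 : ℤ) ∣ a := by exact_mod_cast ha
  obtain ⟨r, rfl⟩ := hm2
  set A : ℤ[X] := C ((a : ℤ) ^ 2) * X with hA
  refine notMem_Qclo_of_sideRelation (a := a) (w := -(a : ℤ) ^ 7) (c := 3)
    (F := C (a : ℤ) * (chordOdd 3).comp A - C (7 ^ 1) * (chordOdd r).comp (C 49 * X))
    (J := C (a : ℤ) * (1 - 2 * A + A ^ 2) - (chordOdd r).comp (C 49 * X)) ha7
    (by rw [Nat.abs_cast]; exact_mod_cast ha2) (m := 2 * r + 1) (by omega) ham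
    ⟨C (a : ℤ) * (chordOdd 3).comp A + C (7 ^ 1) * (chordOdd r).comp (C 49 * X), ?_⟩
    (by norm_num) (fun h => ha7 (Int.prime_ofNat_iff.mpr (by norm_num) |>.dvd_of_dvd_pow
      ((dvd_neg.mp h)))) ?_ ?_ ?_
  · rw [sideRelation, show 7 = 2 * 3 + 1 by rfl, (chordSq_odd_and_even 3).1,
      (chordSq_odd_and_even r).1, pow_comp, pow_comp, ← hA, show (C (7 ^ 1) : ℤ[X]) = 7 from rfl,
      map_pow]
    ring
  · simp only [chordOdd_three, sub_comp, pow_comp, mul_comp, add_comp, one_comp, ofNat_comp, X_comp]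
    rw [show (C (-(a : ℤ) ^ 7) * X ^ 3 : ℤ[X]) = -(C (a : ℤ) * A ^ 3) by
      rw [hA]; simp only [map_neg, map_pow]; ring, show (C (7 ^ 1) : ℤ[X]) = 7 from rfl,
      show (C 7 : ℤ[X]) = 7 from rfl]
    ring
  · intro hm8
    obtain ⟨h1, h2⟩ := natDegree_and_leadingCoeff_dvd 1 (d := r)
      (P := C (a : ℤ) * (chordOdd 3).comp A)
      ((natDegree_C_mul_comp_le _ _ (chordOdd_degree 3).1).trans_lt (by omega))
      (chordOdd_degree r).1 (chordOdd_degree r).2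
    refine ⟨r - 3, 1 + 2 * r, h1.trans (by omega), h2, fun s l hl h => ?_⟩
    have hcop := coprime_sub_seven hm8 hm7
    rw [show 2 * r + 1 - 7 = 2 * (r - 3) by omega] at hcop h
    refine Nat.le_of_dvd hl (hcop.coprime_mul_left.dvd_of_dvd_mul_left (Dvd.intro s ?_))
    exact Nat.eq_of_mul_eq_mul_left two_pos (by rw [← mul_assoc, h, mul_assoc])
  · have h7 := sin_odd_mul_eq α 3
    have hmβ := sin_odd_mul_eq β r
    rw [show ((2 * 3 + 1 : ℕ) : ℝ) * α = π - (2 * r + 1 : ℕ) * β by push_cast at hαβ ⊢; linarith,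
      sin_pi_sub, hmβ, hα, hβ] at h7
    refine mul_left_cancel₀ hu.ne' ?_
    simp only [hA, map_sub, map_mul, aeval_comp, aeval_C, aeval_X, algebraMap_int_eq,
      Int.coe_castRingHom, mul_zero]
    push_cast
    rw [show (49 : ℝ) * (4 * u ^ 2) = 4 * (7 * u) ^ 2 by ring,
      show (a : ℝ) ^ 2 * (4 * u ^ 2) = 4 * (a * u) ^ 2 by ring]
    linear_combination -h7

lemma exists_cyclic_polygon (ha : 0 < a) (ha2 : a ≤ 2) (hm : 0 < m) (h : 2 ≤ m ∨ a = 2) :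
    ∃ α ∈ Set.Ioo 0 (π / 2), ∃ β ∈ Set.Ioo 0 (π / 2),
      7 * α + m * β = π ∧ sin α = a * (sin β / 7) := by
  have ha' : (0 : ℝ) < a := by exact_mod_cast ha
  have ha2' : (a : ℝ) ≤ 2 := by exact_mod_cast ha2
  set f : ℝ → ℝ := fun β => 7 * arcsin (a * (sin β / 7)) + m * β with hf
  have hcont : ContinuousOn f (Set.Icc 0 (π / 2)) := by fun_prop
  have h0 : f 0 < π := by simp [hf, pi_pos]
  have h1 : π < f (π / 2) := by
    have hpos : 0 < arcsin (a * (1 / 7) : ℝ) := arcsin_pos.mpr (by positivity)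
    simp only [hf, sin_pi_div_two]
    rcases h with h | rfl
    · have : (2 : ℝ) ≤ m := by exact_mod_cast h
      nlinarith [pi_pos]
    · have hm' : (1 : ℝ) ≤ m := by exact_mod_cast hm
      have h2 := sin_lt hpos
      rw [sin_arcsin (by norm_num) (by norm_num)] at h2
      norm_num at h2 ⊢
      nlinarith [pi_pos, pi_lt_d2]
  obtain ⟨β, hβ, hβπ⟩ := intermediate_value_Ioo pi_div_two_pos.le hcont ⟨h0, h1⟩
  have hs : 0 < sin β := sin_pos_of_pos_of_lt_pi hβ.1 (by linarith [hβ.2, pi_pos])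
  have hs1 := sin_le_one β
  have hlt : a * (sin β / 7) < 1 := by nlinarith
  have hp : 0 < a * (sin β / 7) := by positivity
  exact ⟨_, ⟨arcsin_pos.mpr hp, arcsin_lt_pi_div_two.mpr hlt⟩, β, hβ, hβπ,
    sin_arcsin (by linarith) hlt.le⟩

lemma sin_pi_div_notMem_Qclo {k : ℕ} (hk : 0 < k) : sin (π / (7 * k : ℕ)) ∉ Qclo ⊥ := by
  intro hu
  have hk' : (k : ℝ) ≠ 0 := by positivity
  have hW : 4 * sin (π / 7) ^ 2 ∈ Qclo ⊥ := by
    have h := sin_mul_sq_eq (π / (7 * k : ℕ)) k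
    rw [show k * (π / (7 * k : ℕ)) = π / 7 by push_cast; field_simp] at h
    rw [h]
    have hx : 4 * sin (π / (7 * k : ℕ)) ^ 2 ∈ Qclo ⊥ := mul_mem (ofNat_mem _ 4) (pow_mem hu 2)
    refine mul_mem (ofNat_mem _ 4) (mul_mem (pow_mem hu 2) ?_)
    rw [aeval_eq_sum_range]
    exact sum_mem fun i _ => zsmul_mem (pow_mem hx i) _
  have hroot : aeval (4 * sin (π / 7) ^ 2) (chordOdd 3) = 0 := by
    have h := sin_odd_mul_eq (π / 7) 3
    rw [show ((2 * 3 + 1 : ℕ) : ℝ) * (π / 7) = π by push_cast; ring, sin_pi] at h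
    refine (mul_eq_zero.mp h.symm).resolve_left (sin_pos_of_pos_of_lt_pi ?_ ?_).ne' <;>
      linarith [pi_pos]
  set W := 4 * sin (π / 7) ^ 2
  have hrel : W ^ 3 = 7 * (1 + W * (W - 2)) := by
    simp only [chordOdd_three, map_sub, map_mul, map_add, map_pow, map_ofNat, map_one,
      aeval_X] at hroot
    linear_combination -hroot
  obtain ⟨B, hB⟩ := exists_valuationSubring_prime_lt_one ℝ (p := 7) (by norm_num)
  set v := B.valuation
  have hB7 : v 7 < 1 := by exact_mod_cast hB
  have h2 : v 2 ≤ 1 := by simpa using v.map_natCast_le_one 2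
  have hW1 : v W < 1 := by
    by_contra hle
    rw [not_lt] at hle
    have h3 : v (1 + W * (W - 2)) ≤ v W ^ 2 := by
      refine v.map_add_le (by rw [map_one]; exact one_le_pow₀ hle) ?_
      rw [map_mul, sq]
      exact mul_le_mul_right (v.map_sub_le le_rfl (h2.trans hle)) _
    have h4 := congrArg v hrel
    rw [map_pow, map_mul, pow_succ, mul_comm] at h4
    have h5 : 0 < v W ^ 2 := zero_lt_iff.mpr (pow_ne_zero 2 (zero_lt_one.trans_le hle).ne')
    have h6 : v 7 * v (1 + W * (W - 2)) < v W ^ 2 :=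
      (mul_le_mul_right h3 _).trans_lt (mul_lt_of_lt_one_left h5 hB7)
    exact (h6.trans_le (le_mul_of_one_le_left zero_le hle)).ne' h4
  refine notMem_Qclo_of_pow_three (v := v) (by norm_num) (by norm_num) hB ?_ hW
  have h3 : v (W * (W - 2)) < 1 := by
    rw [map_mul]
    exact (mul_le_of_le_one_right' (v.map_sub_le hW1.le h2)).trans_lt hW1
  rw [← map_pow, hrel, map_mul, v.map_one_add_of_lt h3, mul_one, Nat.cast_ofNat]

end Polygon

/-- For every `n ≥ 8`, with `ℓ = 7` (or `ℓ = 9` if `n = 14`), there are positive integers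
`a, b`, half central angles `α, β` and `u = 1/(2r) > 0` with `ℓα + (n-ℓ)β = π`,
`sin α = a·u`, `sin β = b·u`, and `u` is not in the real quadratic closure of `ℚ`
(the prime subfield `⊥` of `ℝ`); i.e., `n ∈ NCL₂`. -/
theorem statement0 (n : ℕ) (hn : 8 ≤ n) :
    ∃ (a b : ℕ) (α β u : ℝ), 0 < a ∧ 0 < b ∧
      α ∈ Set.Ioo 0 (π / 2) ∧ β ∈ Set.Ioo 0 (π / 2) ∧ 0 < u ∧
      ((if n = 14 then 9 else 7 : ℕ) : ℝ) * α
        + ((n : ℝ) - ((if n = 14 then 9 else 7 : ℕ) : ℝ)) * β = π ∧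
      Real.sin α = a * u ∧ Real.sin β = b * u ∧
      u ∉ Qclo ⊥ := by
  by_cases h7 : 7 ∣ n
  · obtain ⟨k, rfl⟩ := h7
    have hn' : (8 : ℝ) ≤ (7 * k : ℕ) := by exact_mod_cast hn
    have hpos : 0 < π / (7 * k : ℕ) := by positivity
    have hlt : π / (7 * k : ℕ) < π / 2 := div_lt_div_of_pos_left pi_pos two_pos (by linarith)
    refine ⟨1, 1, π / (7 * k : ℕ), π / (7 * k : ℕ), sin (π / (7 * k : ℕ)), one_pos, one_pos,
      ⟨hpos, hlt⟩, ⟨hpos, hlt⟩, sin_pos_of_pos_of_lt_pi hpos (by linarith), ?_, by simp, by simp,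
      sin_pi_div_notMem_Qclo (by omega)⟩
    rw [← add_mul, add_sub_cancel, mul_div_cancel₀ _ (by linarith)]
  obtain ⟨m, rfl⟩ : ∃ m, n = 7 + m := ⟨n - 7, by omega⟩
  have hm7 : ¬ 7 ∣ m := fun h => h7 (by omega)
  have h14 : ¬ 7 + m = 14 := by omega
  have hm : 0 < m := by omega
  obtain ⟨a, ha, ha2, ham, hma⟩ : ∃ a : ℕ, 0 < a ∧ a ≤ 2 ∧ ¬ (7 : ℤ) ∣ a ^ 2 - m ^ 2 ∧
      (2 ≤ m ∨ a = 2) := by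
    by_cases h1 : (7 : ℤ) ∣ 1 - m ^ 2
    · refine ⟨2, two_pos, le_rfl, fun h => ?_, Or.inr rfl⟩
      have := dvd_sub h h1
      norm_num at this
    · refine ⟨1, one_pos, one_le_two, by simpa using h1, Or.inl ?_⟩
      by_contra hlt
      obtain rfl : m = 1 := by omega
      norm_num at h1
  obtain ⟨α, hα, β, hβ, hαβ, hsin⟩ := exists_cyclic_polygon ha ha2 hm hma
  have hu : 0 < sin β / 7 := div_pos (sin_pos_of_pos_of_lt_pi hβ.1 (by linarith [hβ.2, pi_pos]))
    (by norm_num)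
  have hβ7 : sin β = 7 * (sin β / 7) := by ring
  have ha7 : ¬ 7 ∣ a := Nat.not_dvd_of_pos_of_lt ha (by omega)
  refine ⟨a, 7, α, β, sin β / 7, ha, by norm_num, hα, hβ, hu, ?_, hsin, by simpa using hβ7, ?_⟩
  · rw [if_neg h14]
    push_cast
    linear_combination hαβ
  · rcases Nat.even_or_odd m with hm2 | hm2
    · exact notMem_Qclo_of_even hu hsin hβ7 hαβ ha7 ha2 hm hm7 ham hm2
    · exact notMem_Qclo_of_odd hu hsin hβ7 hαβ ha7 ha2 hm7 ham hm2
end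

section
/- Let n ≥ 8 be an even integer, let p be a prime with n/2 < p < n, and let a, b be positive integers with a ≡ 1 (mod p²) and b ≡ 0 (mod p²). Define the polynomials f⁽¹⁾(x) = Σ_{j odd, 1≤j≤p} (−1)^{(j−1)/2} · C(p,j) · (1−a²x²)^{(p−j)/2} · (ax)^j − Σ_{j odd, 1≤j≤n−p} (−1)^{(j−1)/2} · C(n−p,j) · (1−b²x²)^{(n−p−j)/2} · (bx)^j, and f⁽²⁾(x) equal to the same expression with the minus sign between the two sums replaced by a plus sign. Then f⁽¹⁾ and f⁽²⁾ are polynomials with integer coefficients, each is divisible by x, and for v = 1, 2 the polynomial f⁽ᵛ⁾(x)/x is irreducible in ℚ[x] and has degree p − 1. -/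
open Polynomial

/-- `sinPoly k a` is `Σ_{j odd, 1 ≤ j ≤ k} (−1)^{(j−1)/2} · C(k,j) · (1−a²x²)^{(k−j)/2} · (a·x)^j`,
an element of `ℤ[x]` (for `k` odd the exponents `(k−j)/2` are genuine natural numbers). -/
noncomputable def sinPoly (k : ℕ) (a : ℤ) : Polynomial ℤ :=
  ∑ j ∈ Finset.Icc 1 k,
    if Odd j then
      ((-1 : ℤ) ^ ((j - 1) / 2) * (k.choose j)) •
        ((1 - (C a) ^ 2 * X ^ 2) ^ ((k - j) / 2) * (C a * X) ^ j)
    else 0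

/-- Eisenstein's criterion over `ℚ`, for integer polynomials that need not be primitive. -/
theorem irreducible_map_rat_of_eisenstein {g : ℤ[X]} {p : ℕ} (hp : p.Prime)
    (hdeg : 0 < g.natDegree) (hlead : ¬ (p : ℤ) ∣ g.leadingCoeff)
    (hcoeff : ∀ i < g.natDegree, (p : ℤ) ∣ g.coeff i) (hzero : ¬ (p : ℤ) ^ 2 ∣ g.coeff 0) :
    Irreducible (g.map (Int.castRingHom ℚ)) := by
  have hpZ : Prime (p : ℤ) := Nat.prime_iff_prime_int.mp hp
  have hfac (i : ℕ) : g.coeff i = g.content * g.primPart.coeff i := by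
    conv_lhs => rw [g.eq_C_content_mul_primPart, coeff_C_mul]
  have hcontent : ¬ (p : ℤ) ∣ g.content := fun h => hlead (h.trans (g.content_dvd_coeff _))
  have hprim : Irreducible g.primPart := by
    refine IsEisensteinAt.irreducible (𝓟 := Ideal.span {(p : ℤ)}) ⟨?_, fun {i} hi => ?_, ?_⟩
      ((Ideal.span_singleton_prime hpZ.ne_zero).mpr hpZ) g.isPrimitive_primPart
      (by rwa [natDegree_primPart])
    · rw [Ideal.mem_span_singleton]
      intro h
      rw [leadingCoeff, natDegree_primPart] at h
      exact hlead (by rw [leadingCoeff, hfac]; exact h.mul_left _)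
    · rw [natDegree_primPart] at hi
      have h := hcoeff i hi
      rw [hfac] at h
      exact Ideal.mem_span_singleton.mpr ((hpZ.dvd_or_dvd h).resolve_left hcontent)
    · rw [Ideal.span_singleton_pow, Ideal.mem_span_singleton]
      exact fun h => hzero (by rw [hfac]; exact h.mul_left _)
  have hunit : IsUnit (C ((g.content : ℤ) : ℚ)) := by
    rw [isUnit_C, isUnit_iff_ne_zero]
    intro h
    exact hcontent (by rw [Int.cast_eq_zero.mp h]; exact dvd_zero _)
  rw [g.eq_C_content_mul_primPart, Polynomial.map_mul, map_C]
  exact (irreducible_isUnit_mul hunit).mpr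
    ((IsPrimitive.Int.irreducible_iff_irreducible_map_cast g.isPrimitive_primPart).mp hprim)

theorem C_mul_X_dvd_sinPoly (k : ℕ) (a : ℤ) : C a * X ∣ sinPoly k a := by
  refine Finset.dvd_sum fun j hj => ?_
  split_ifs
  · exact dvd_smul_of_dvd _
      ((dvd_pow_self _ (by have := Finset.mem_Icc.mp hj; omega)).mul_left _)
  · exact dvd_zero _

theorem coeff_zero_sinPoly (k : ℕ) (a : ℤ) : (sinPoly k a).coeff 0 = 0 :=
  X_dvd_iff.mp ((dvd_mul_left _ _).trans (C_mul_X_dvd_sinPoly k a))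

theorem dvd_coeff_sinPoly {m a : ℤ} (h : m ∣ a) (k i : ℕ) : m ∣ (sinPoly k a).coeff i :=
  h.trans ((C_dvd_iff_dvd_coeff _ _).mp ((dvd_mul_right _ _).trans (C_mul_X_dvd_sinPoly k a)) i)

theorem natDegree_sinPoly_le (k : ℕ) (a : ℤ) : (sinPoly k a).natDegree ≤ k := by
  refine natDegree_sum_le_of_forall_le _ _ fun j hj => ?_
  rw [Finset.mem_Icc] at hj
  split_ifs
  · refine (natDegree_smul_le _ _).trans (natDegree_mul_le.trans ?_)
    have h₁ : ((1 - C a ^ 2 * X ^ 2 : ℤ[X]) ^ ((k - j) / 2)).natDegree ≤ (k - j) / 2 * 2 :=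
      natDegree_pow_le_of_le _ (by compute_degree)
    have h₂ : ((C a * X : ℤ[X]) ^ j).natDegree ≤ j * 1 :=
      natDegree_pow_le_of_le _ (natDegree_C_mul_le _ _ |>.trans natDegree_X_le)
    omega
  · simp

theorem coeff_one_sinPoly {k : ℕ} (hk : 1 ≤ k) (a : ℤ) : (sinPoly k a).coeff 1 = k * a := by
  rw [sinPoly, finsetSum_coeff, Finset.sum_eq_single_of_mem 1 (by simpa using hk)]
  · simp [← mul_assoc, coeff_mul_X, coeff_zero_eq_eval_zero]
  · intro j hj hj1
    rw [Finset.mem_Icc] at hj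
    split_ifs
    · rw [coeff_smul, mul_pow, ← mul_assoc, coeff_mul_X_pow', if_neg (by omega), smul_zero]
    · exact coeff_zero _

/-- Modulo an odd prime `p` only the term `j = p` of `sinPoly p a` survives. -/
theorem dvd_coeff_sinPoly_sub {p : ℕ} (hp : p.Prime) (hodd : Odd p) (a : ℤ) (i : ℕ) :
    (p : ℤ) ∣ (sinPoly p a - C ((-1) ^ ((p - 1) / 2)) * (C a * X) ^ p).coeff i := by
  refine (C_dvd_iff_dvd_coeff _ _).mp ?_ i
  rw [sinPoly, ← Finset.add_sum_erase _ _ (Finset.mem_Icc.mpr ⟨hp.one_le, le_rfl⟩),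
    if_pos hodd, smul_eq_C_mul]
  simp only [Nat.choose_self, Nat.sub_self, Nat.zero_div, pow_zero, one_mul, Nat.cast_one,
    mul_one, add_sub_cancel_left]
  refine Finset.dvd_sum fun j hj => ?_
  rw [Finset.mem_erase, Finset.mem_Icc] at hj
  split_ifs
  · rw [smul_eq_C_mul]
    refine (_root_.map_dvd C ?_).mul_right _
    exact (Int.natCast_dvd_natCast.mpr
      (hp.dvd_choose_self (by omega) (by omega))).mul_left _
  · exact dvd_zero _

theorem dvd_coeff_sinPoly_self {p i : ℕ} (hp : p.Prime) (hodd : Odd p) (a : ℤ) (hi : i ≠ p) :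
    (p : ℤ) ∣ (sinPoly p a).coeff i := by
  have h := dvd_coeff_sinPoly_sub hp hodd a i
  rwa [coeff_sub, coeff_C_mul, mul_pow, ← C_pow, coeff_C_mul, coeff_X_pow, if_neg hi, mul_zero,
    mul_zero, sub_zero] at h

theorem not_dvd_coeff_sinPoly_self {p : ℕ} (hp : p.Prime) (hodd : Odd p) {a : ℤ}
    (ha : ¬ (p : ℤ) ∣ a) : ¬ (p : ℤ) ∣ (sinPoly p a).coeff p := by
  intro h
  have hpZ : Prime (p : ℤ) := Nat.prime_iff_prime_int.mp hp
  have h' := dvd_coeff_sinPoly_sub hp hodd a p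
  rw [coeff_sub, dvd_sub_right h, coeff_C_mul, mul_pow, ← C_pow, coeff_C_mul, coeff_X_pow_self,
    mul_one] at h'
  rcases hpZ.dvd_or_dvd h' with h' | h'
  · exact hpZ.not_isUnit (isUnit_of_dvd_unit h' (isUnit_one.neg.pow _))
  · exact ha (hpZ.dvd_of_dvd_pow h')

/-- A perturbation of `sinPoly p a` that vanishes modulo `p²` and has degree at most `p` is
`X` times an Eisenstein polynomial. -/
theorem exists_eq_X_mul_irreducible {p : ℕ} (hp : p.Prime) (hodd : Odd p) {a : ℤ}
    (ha : ¬ (p : ℤ) ∣ a) {r : ℤ[X]} (hr0 : r.coeff 0 = 0) (hrdeg : r.natDegree ≤ p)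
    (hr : ∀ i, (p : ℤ) ^ 2 ∣ r.coeff i) :
    ∃ g : ℤ[X], sinPoly p a + r = X * g ∧ g.natDegree = p - 1 ∧
      Irreducible (g.map (Int.castRingHom ℚ)) := by
  have hr' (i : ℕ) : (p : ℤ) ∣ r.coeff i := (dvd_pow_self _ two_ne_zero).trans (hr i)
  have htop : ¬ (p : ℤ) ∣ (sinPoly p a + r).coeff p := by
    rw [coeff_add, dvd_add_left (hr' p)]
    exact not_dvd_coeff_sinPoly_self hp hodd ha
  have hdeg : (sinPoly p a + r).natDegree = p :=
    natDegree_eq_of_le_of_coeff_ne_zero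
      (natDegree_add_le_of_degree_le (natDegree_sinPoly_le p a) hrdeg)
      fun h => htop (h ▸ dvd_zero _)
  have hp2 := hp.two_le
  have hgdeg : (sinPoly p a + r).divX.natDegree = p - 1 := by
    rw [natDegree_divX_eq_natDegree_tsub_one, hdeg]
  refine ⟨(sinPoly p a + r).divX, ?_, hgdeg, ?_⟩
  · conv_lhs => rw [← X_mul_divX_add (sinPoly p a + r)]
    simp [coeff_zero_sinPoly, hr0]
  · refine irreducible_map_rat_of_eisenstein hp (by omega) ?_ (fun i hi => ?_) ?_
    · rwa [leadingCoeff, hgdeg, coeff_divX, Nat.sub_add_cancel hp.one_le]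
    · rw [coeff_divX, coeff_add]
      exact dvd_add (dvd_coeff_sinPoly_self hp hodd a (by omega)) (hr' _)
    · rw [coeff_divX, coeff_add, dvd_add_left (hr _), zero_add, coeff_one_sinPoly hp.one_le, sq,
        mul_dvd_mul_iff_left (Nat.cast_ne_zero.mpr hp.ne_zero)]
      exact ha

/-- For even `n ≥ 8`, a prime `p` with `n/2 < p < n`, and positive integers `a ≡ 1`,
`b ≡ 0 (mod p²)`, both polynomials `f⁽¹⁾ = sinPoly p a − sinPoly (n−p) b` and
`f⁽²⁾ = sinPoly p a + sinPoly (n−p) b` are divisible by `x`, and the quotient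
`f⁽ᵛ⁾/x` has degree `p − 1` and is irreducible in `ℚ[x]`. -/
theorem statement1 (n p : ℕ) (a b : ℤ) (hn : 8 ≤ n) (hne : Even n)
    (hp : p.Prime) (hp1 : n < 2 * p) (hp2 : p < n)
    (ha : a ≡ 1 [ZMOD (p ^ 2 : ℕ)]) (hb : b ≡ 0 [ZMOD (p ^ 2 : ℕ)])
    (ha0 : 0 < a) (hb0 : 0 < b) :
    ∀ f ∈ ({sinPoly p a - sinPoly (n - p) b,
            sinPoly p a + sinPoly (n - p) b} : Set (Polynomial ℤ)),
      ∃ g : Polynomial ℤ, f = X * g ∧ g.natDegree = p - 1 ∧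
        Irreducible (g.map (Int.castRingHom ℚ)) := by
  have hodd : Odd p := hp.odd_of_ne_two (by omega)
  have hpa : ¬ (p : ℤ) ∣ a := by
    intro h
    have h1 : (p : ℤ) ∣ 1 - a :=
      (dvd_pow_self _ two_ne_zero).trans (by exact_mod_cast ha.dvd)
    exact (Nat.prime_iff_prime_int.mp hp).not_dvd_one (by simpa using dvd_add h1 h)
  have hpb : (p : ℤ) ^ 2 ∣ b := by exact_mod_cast Int.modEq_zero_iff_dvd.mp hb
  have hdeg : (sinPoly (n - p) b).natDegree ≤ p :=
    (natDegree_sinPoly_le _ _).trans (by omega)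
  rintro f (rfl | rfl)
  · rw [sub_eq_add_neg]
    refine exists_eq_X_mul_irreducible hp hodd hpa ?_ (by rwa [natDegree_neg]) fun i => ?_
    · rw [coeff_neg, coeff_zero_sinPoly, neg_zero]
    · rw [coeff_neg, dvd_neg]
      exact dvd_coeff_sinPoly hpb _ _
  · exact exists_eq_X_mul_irreducible hp hodd hpa (coeff_zero_sinPoly _ _) hdeg
      (dvd_coeff_sinPoly hpb _)
end

section
/- Let n ≥ 8 be an even integer and let p be a prime with n/2 < p < n such that p − 1 is not a power of 2 (p is not a Fermat prime). Let a, b be positive integers with a ≡ 1 (mod p²) and b ≡ 0 (mod p²). If u > 0 is a real number and α, β are real numbers satisfying p·α + (n−p)·β = π, cos α = a·u and cos β = b·u, then u does not belong to Qclo(ℚ). (This expresses that the cyclic n-gon whose sides have distances a (p times) and b (n−p times) from the circumcenter is not constructible, i.e., n ∈ NCD₂ for even n ≥ 8.) -/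
open Real

open Polynomial IntermediateField

/-- `K` is obtained from `ℚ` by finitely many adjunctions of real square roots. -/
inductive IsQuadraticTower : IntermediateField ℚ ℝ → Prop
  | bot : IsQuadraticTower ⊥
  | adjoin_sqrt (K : IntermediateField ℚ ℝ) (s : ℝ) :
      IsQuadraticTower K → s ^ 2 ∈ K → IsQuadraticTower (K ⊔ ℚ⟮s⟯)

namespace IsQuadraticTower

theorem exists_le {K L : IntermediateField ℚ ℝ} (hK : IsQuadraticTower K)
    (hL : IsQuadraticTower L) : ∃ T, IsQuadraticTower T ∧ K ≤ T ∧ L ≤ T := by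
  induction hL with
  | bot => exact ⟨K, hK, le_rfl, bot_le⟩
  | adjoin_sqrt L s _ hs ih =>
    obtain ⟨T, hT, hKT, hLT⟩ := ih
    exact ⟨T ⊔ ℚ⟮s⟯, .adjoin_sqrt T s hT (hLT hs), hKT.trans le_sup_left,
      sup_le_sup_right hLT _⟩

theorem finrank_eq_two_pow {K : IntermediateField ℚ ℝ} (hK : IsQuadraticTower K) :
    ∃ k : ℕ, Module.finrank ℚ K = 2 ^ k := by
  induction hK with
  | bot => exact ⟨0, by simp⟩
  | adjoin_sqrt K s _ hs ih =>
    obtain ⟨k, hk⟩ := ih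
    let P : K[X] := X ^ 2 - Polynomial.C ⟨s ^ 2, hs⟩
    have hPm : P.Monic := monic_X_pow_sub_C _ two_ne_zero
    have hP0 : aeval s P = 0 := by
      simp only [P, map_sub, map_pow, aeval_X, aeval_C]
      exact sub_self _
    have hint : IsIntegral K s := ⟨P, hPm, hP0⟩
    have hdeg : (minpoly K s).natDegree ≤ 2 := by
      have := natDegree_le_of_dvd (minpoly.dvd K s hP0) hPm.ne_zero
      rwa [natDegree_X_pow_sub_C] at this
    have hpos := minpoly.natDegree_pos hint
    have hmul : Module.finrank ℚ ↥(K ⊔ ℚ⟮s⟯) = 2 ^ k * (minpoly K s).natDegree := by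
      have hsup : (adjoin K {s}).restrictScalars ℚ = K ⊔ ℚ⟮s⟯ :=
        restrictScalars_adjoin_eq_sup ℚ K {s}
      rw [← hsup, ← hk, ← adjoin.finrank hint]
      exact (Module.finrank_mul_finrank ℚ K (adjoin K {s})).symm
    rw [hmul]
    obtain h | h : (minpoly K s).natDegree = 1 ∨ (minpoly K s).natDegree = 2 := by omega
    · exact ⟨k, by rw [h, mul_one]⟩
    · exact ⟨k + 1, by rw [h, pow_succ]⟩

/-- The union of all quadratic towers. -/
def union : Subfield ℝ where
  carrier := {x | ∃ K, IsQuadraticTower K ∧ x ∈ K}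
  mul_mem' := by
    rintro x y ⟨K, hK, hx⟩ ⟨L, hL, hy⟩
    obtain ⟨T, hT, hKT, hLT⟩ := hK.exists_le hL
    exact ⟨T, hT, mul_mem (hKT hx) (hLT hy)⟩
  one_mem' := ⟨⊥, .bot, one_mem _⟩
  add_mem' := by
    rintro x y ⟨K, hK, hx⟩ ⟨L, hL, hy⟩
    obtain ⟨T, hT, hKT, hLT⟩ := hK.exists_le hL
    exact ⟨T, hT, add_mem (hKT hx) (hLT hy)⟩
  zero_mem' := ⟨⊥, .bot, zero_mem _⟩
  neg_mem' := by
    rintro x ⟨K, hK, hx⟩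
    exact ⟨K, hK, neg_mem hx⟩
  inv_mem' := by
    rintro x ⟨K, hK, hx⟩
    exact ⟨K, hK, inv_mem hx⟩

theorem Qclo_bot_le_union : Qclo ⊥ ≤ union := by
  refine sInf_le ⟨bot_le, ?_⟩
  rintro c ⟨K, hK, hc⟩ hc0
  refine ⟨K ⊔ ℚ⟮√c⟯, .adjoin_sqrt K _ hK (by rwa [Real.sq_sqrt hc0]), ?_⟩
  exact (le_sup_right : ℚ⟮√c⟯ ≤ K ⊔ ℚ⟮√c⟯) (mem_adjoin_simple_self ℚ _)

end IsQuadraticTower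

theorem natDegree_minpoly_eq_two_pow_of_mem_Qclo {x : ℝ} (hx : x ∈ Qclo ⊥) :
    ∃ k : ℕ, (minpoly ℚ x).natDegree = 2 ^ k := by
  obtain ⟨K, hK, hxK⟩ := IsQuadraticTower.Qclo_bot_le_union hx
  obtain ⟨k, hk⟩ := hK.finrank_eq_two_pow
  have : FiniteDimensional ℚ K := Module.finite_of_finrank_pos (by rw [hk]; positivity)
  have hdvd : (minpoly ℚ (⟨x, hxK⟩ : K)).natDegree ∣ 2 ^ k :=
    hk ▸ minpoly.degree_dvd (IsIntegral.of_finite ℚ _)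
  rw [← minpoly.algebraMap_eq (algebraMap K ℝ).injective] at hdvd
  obtain ⟨j, -, hj⟩ := (Nat.dvd_prime_pow Nat.prime_two).mp hdvd
  exact ⟨j, hj⟩

theorem natDegree_minpoly_eq_of_eisenstein {f : ℤ[X]} {p : ℤ} (hp : Prime p)
    (hlead : ¬ p ∣ f.leadingCoeff) (hmem : ∀ i < f.natDegree, p ∣ f.coeff i)
    (h0 : ¬ p ^ 2 ∣ f.coeff 0) (hdeg : 0 < f.natDegree) {x : ℝ} (hx : aeval x f = 0) :
    (minpoly ℚ x).natDegree = f.natDegree := by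
  have hf : f ≠ 0 := by rintro rfl; simp at hdeg
  have hcoeff (i : ℕ) : f.coeff i = f.content * f.primPart.coeff i := by
    conv_lhs => rw [f.eq_C_content_mul_primPart, coeff_C_mul]
  have hcontent : ¬ p ∣ f.content := fun h => hlead (h.trans (content_dvd_coeff _))
  have hprim := f.isPrimitive_primPart
  have heis : f.primPart.IsEisensteinAt (Ideal.span {p}) := by
    refine ⟨?_, ?_, ?_⟩
    · rw [Ideal.mem_span_singleton, leadingCoeff, natDegree_primPart]
      intro h
      exact hlead (by rw [leadingCoeff, hcoeff]; exact h.mul_left _)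
    · intro i hi
      rw [natDegree_primPart] at hi
      rw [Ideal.mem_span_singleton]
      have := hmem i hi
      rw [hcoeff] at this
      exact (hp.dvd_or_dvd this).resolve_left hcontent
    · rw [Ideal.span_singleton_pow, Ideal.mem_span_singleton]
      intro h
      exact h0 (by rw [hcoeff]; exact h.mul_left _)
  have hirr : Irreducible f.primPart := heis.irreducible
    ((Ideal.span_singleton_prime hp.ne_zero).mpr hp) hprim (by rwa [natDegree_primPart])
  have hirr' := (IsPrimitive.Int.irreducible_iff_irreducible_map_cast hprim).mp hirr
  have hroot : aeval x (f.primPart.map (Int.castRingHom ℚ)) = 0 := by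
    have h := hx
    rw [f.eq_C_content_mul_primPart, map_mul, aeval_C] at h
    have hne : (algebraMap ℤ ℝ) f.content ≠ 0 := by simpa [content_eq_zero_iff] using hf
    have := (mul_eq_zero.mp h).resolve_left hne
    rwa [← algebraMap_int_eq, aeval_map_algebraMap]
  rw [← minpoly.eq_of_irreducible hirr' hroot,
    natDegree_mul_C (inv_ne_zero (leadingCoeff_ne_zero.mpr hirr'.ne_zero)),
    natDegree_map_eq_of_injective Int.cast_injective, natDegree_primPart]

theorem aeval_dickson_two_mul_cos (n : ℕ) (θ : ℝ) :
    aeval (2 * Real.cos θ) (dickson 1 (1 : ℤ) n) = 2 * Real.cos (n * θ) := by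
  rw [dickson_one_one_eq_chebyshev_C, Chebyshev.aeval_C]
  exact_mod_cast Chebyshev.C_two_mul_real_cos θ n

theorem natDegree_dickson_one_one_le (n : ℕ) : (dickson 1 (1 : ℤ) n).natDegree ≤ n := by
  induction n using Nat.twoStepInduction with
  | zero => rw [dickson_zero, show (3 - ((1 : ℕ) : ℤ[X])) = Polynomial.C 2 by norm_num,
      natDegree_C]
  | one => simp
  | more n h0 h1 =>
    rw [dickson_add_two, map_one, one_mul]
    exact (natDegree_sub_le_of_le (natDegree_mul_le_of_le natDegree_X_le h1) h0).trans (by omega)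

theorem coeff_self_dickson_one_one (n : ℕ) : (dickson 1 (1 : ℤ) (n + 1)).coeff (n + 1) = 1 := by
  induction n with
  | zero => simp
  | succ n ih =>
    rw [dickson_add_two, map_one, one_mul, coeff_sub, coeff_X_mul, ih,
      coeff_eq_zero_of_natDegree_lt ((natDegree_dickson_one_one_le n).trans_lt (by omega)),
      sub_zero]

theorem coeff_zero_dickson_one_one (k : ℕ) :
    (dickson 1 (1 : ℤ) (2 * k)).coeff 0 = 2 * (-1) ^ k ∧
      (dickson 1 (1 : ℤ) (2 * k + 1)).coeff 0 = 0 := by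
  induction k with
  | zero => constructor <;> simp [coeff_zero_eq_eval_zero]
  | succ k ih =>
    rw [show 2 * (k + 1) + 1 = 2 * k + 1 + 2 by ring, show 2 * (k + 1) = 2 * k + 2 by ring,
      dickson_add_two, dickson_add_two, map_one, one_mul, one_mul]
    simp only [coeff_sub, mul_coeff_zero, coeff_X_zero, ih]
    constructor <;> ring

theorem coeff_one_dickson_one_one (k : ℕ) :
    (dickson 1 (1 : ℤ) (2 * k + 1)).coeff 1 = (-1) ^ k * (2 * k + 1) := by
  induction k with
  | zero => simp
  | succ k ih =>
    rw [show 2 * (k + 1) + 1 = 2 * k + 1 + 2 by ring, dickson_add_two, map_one, one_mul,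
      coeff_sub, ih, coeff_X_mul, show 2 * k + 1 + 1 = 2 * (k + 1) by ring,
      (coeff_zero_dickson_one_one (k + 1)).1]
    push_cast
    ring

theorem dvd_coeff_dickson_one_one {p i : ℕ} (hp : p.Prime) (hi : i < p) :
    (p : ℤ) ∣ (dickson 1 (1 : ℤ) p).coeff i := by
  have : Fact p.Prime := ⟨hp⟩
  rw [← ZMod.intCast_zmod_eq_zero_iff_dvd, ← eq_intCast (Int.castRingHom (ZMod p)), ← coeff_map,
    map_dickson, map_one, dickson_one_one_zmod_p, coeff_X_pow, if_neg hi.ne]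

/-- `D_p(aX) + D_q(bX)`, divided by `X`, where `D` denotes the Dickson polynomials. -/
noncomputable def sidePoly (p q a b : ℕ) : ℤ[X] :=
  divX ((dickson 1 1 p).comp (Polynomial.C (a : ℤ) * X) +
    (dickson 1 1 q).comp (Polynomial.C (b : ℤ) * X))

theorem coeff_sidePoly (p q a b i : ℕ) : (sidePoly p q a b).coeff i =
    (dickson 1 (1 : ℤ) p).coeff (i + 1) * a ^ (i + 1) +
      (dickson 1 (1 : ℤ) q).coeff (i + 1) * b ^ (i + 1) := by
  rw [sidePoly, coeff_divX, coeff_add, comp_C_mul_X_coeff, comp_C_mul_X_coeff]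

theorem coeff_sidePoly_pred {p q a b : ℕ} (hqp : q < p) :
    (sidePoly p q a b).coeff (p - 1) = a ^ p := by
  obtain ⟨m, rfl⟩ : ∃ m, p = m + 1 := ⟨p - 1, by omega⟩
  rw [coeff_sidePoly, Nat.add_sub_cancel, coeff_self_dickson_one_one,
    coeff_eq_zero_of_natDegree_lt ((natDegree_dickson_one_one_le q).trans_lt hqp)]
  ring

theorem natDegree_sidePoly {p q a b : ℕ} (hqp : q < p) (ha : a ≠ 0) :
    (sidePoly p q a b).natDegree = p - 1 := by
  refine natDegree_eq_of_le_of_coeff_ne_zero ?_ ?_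
  · refine natDegree_le_iff_coeff_eq_zero.mpr fun i hi => ?_
    rw [coeff_sidePoly,
      coeff_eq_zero_of_natDegree_lt ((natDegree_dickson_one_one_le p).trans_lt (by omega)),
      coeff_eq_zero_of_natDegree_lt ((natDegree_dickson_one_one_le q).trans_lt (by omega))]
    ring
  · rw [coeff_sidePoly_pred hqp]
    exact pow_ne_zero _ (by exact_mod_cast ha)

theorem aeval_sidePoly_eq_zero {p q a b : ℕ} (hp : Odd p) (hq : Odd q) {u α β : ℝ} (hu : u ≠ 0)
    (hsum : p * α + q * β = π) (hα : Real.cos α = a * u) (hβ : Real.cos β = b * u) :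
    aeval (2 * u) (sidePoly p q a b) = 0 := by
  obtain ⟨k, rfl⟩ := hp
  obtain ⟨l, rfl⟩ := hq
  set G : ℤ[X] := (dickson 1 1 (2 * k + 1)).comp (Polynomial.C (a : ℤ) * X) +
    (dickson 1 1 (2 * l + 1)).comp (Polynomial.C (b : ℤ) * X) with hG
  have hG0 : G.coeff 0 = 0 := by
    rw [hG, coeff_add, comp_C_mul_X_coeff, comp_C_mul_X_coeff,
      (coeff_zero_dickson_one_one k).2, (coeff_zero_dickson_one_one l).2]
    ring
  have hGu : aeval (2 * u) G = 0 := by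
    have h1 : aeval (2 * u) (Polynomial.C (a : ℤ) * X) = 2 * Real.cos α := by
      simp [hα]; ring
    have h2 : aeval (2 * u) (Polynomial.C (b : ℤ) * X) = 2 * Real.cos β := by
      simp [hβ]; ring
    rw [hG, map_add, aeval_comp, aeval_comp, h1, h2, aeval_dickson_two_mul_cos,
      aeval_dickson_two_mul_cos, eq_sub_of_add_eq hsum, Real.cos_pi_sub]
    ring
  rw [← divX_mul_X_add G, hG0, map_zero, add_zero, map_mul, aeval_X] at hGu
  exact (mul_eq_zero.mp hGu).resolve_right (mul_ne_zero two_ne_zero hu)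

theorem natDegree_minpoly_of_aeval_sidePoly_eq_zero {p q a b : ℕ} (hp : p.Prime) (hp2 : Odd p)
    (hqp : q < p) (ha : a ≡ 1 [MOD p ^ 2]) (hb : b ≡ 0 [MOD p ^ 2]) (ha0 : a ≠ 0)
    {x : ℝ} (hx : aeval x (sidePoly p q a b) = 0) : (minpoly ℚ x).natDegree = p - 1 := by
  have hpZ : Prime (p : ℤ) := Nat.prime_iff_prime_int.mp hp
  have hbdvd : (p : ℤ) ^ 2 ∣ b := by exact_mod_cast (Nat.modEq_zero_iff_dvd.mp hb)
  have hpa : ¬ p ∣ a := fun h => hp.one_lt.ne' <| Nat.dvd_one.mp <|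
    ((ha.of_dvd (dvd_pow_self p two_ne_zero)).dvd_iff dvd_rfl).mp h
  have hpaZ : ¬ (p : ℤ) ∣ a := by exact_mod_cast hpa
  have hdeg := natDegree_sidePoly (b := b) hqp ha0
  have := hp.two_le
  rw [natDegree_minpoly_eq_of_eisenstein hpZ ?_ ?_ ?_ (by omega) hx, hdeg]
  · rw [leadingCoeff, hdeg, coeff_sidePoly_pred hqp]
    exact fun h => hpaZ (hpZ.dvd_of_dvd_pow h)
  · intro i hi
    rw [coeff_sidePoly]
    refine dvd_add ((dvd_coeff_dickson_one_one hp (by omega)).mul_right _) ?_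
    exact (((dvd_pow_self _ two_ne_zero).trans hbdvd).trans
      (dvd_pow_self _ (by omega))).mul_left _
  · obtain ⟨k, hk⟩ := hp2
    rw [coeff_sidePoly, zero_add, pow_one, pow_one, dvd_add_left (hbdvd.mul_left _)]
    have hcoeff : (dickson 1 (1 : ℤ) p).coeff 1 = p * (-1) ^ k := by
      rw [hk, coeff_one_dickson_one_one]
      push_cast
      ring
    rw [hcoeff, sq, mul_assoc, mul_dvd_mul_iff_left hpZ.ne_zero]
    intro h
    rcases hpZ.dvd_or_dvd h with h | h
    · exact hpZ.not_isUnit (isUnit_of_dvd_unit h (IsUnit.pow _ isUnit_one.neg))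
    · exact hpaZ h

/-- Let `n ≥ 8` be even, `p` a prime with `n/2 < p < n` which is not a Fermat prime,
and `a ≡ 1`, `b ≡ 0 (mod p²)` positive integers.  If `u > 0` and `α, β` satisfy
`p·α + (n−p)·β = π`, `cos α = a·u`, `cos β = b·u`, then `u` is not in the real
quadratic closure of `ℚ` (the prime subfield `⊥` of `ℝ`); i.e., `n ∈ NCD₂`. -/
theorem statement2 (n p a b : ℕ) (hn : 8 ≤ n) (hne : Even n)
    (hp : p.Prime) (hp1 : n < 2 * p) (hp2 : p < n)
    (hfermat : ¬ ∃ s : ℕ, p - 1 = 2 ^ s)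
    (ha : a ≡ 1 [MOD p ^ 2]) (hb : b ≡ 0 [MOD p ^ 2])
    (ha0 : 0 < a) (hb0 : 0 < b)
    (u α β : ℝ) (hu : 0 < u)
    (hsum : (p : ℝ) * α + ((n : ℝ) - (p : ℝ)) * β = π)
    (hcα : Real.cos α = a * u) (hcβ : Real.cos β = b * u) :
    u ∉ Qclo ⊥ := by
  obtain ⟨q, rfl⟩ := Nat.exists_eq_add_of_lt hp2
  have hp_odd : Odd p := hp.odd_of_ne_two (by omega)
  have hq_odd : Odd (q + 1) := by
    rw [add_assoc, Nat.even_add'] at hne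
    exact hne.mp hp_odd
  intro hmem
  have hroot := aeval_sidePoly_eq_zero (q := q + 1) hp_odd hq_odd hu.ne'
    (by rw [← hsum]; push_cast; ring) hcα hcβ
  have hdeg := natDegree_minpoly_of_aeval_sidePoly_eq_zero hp hp_odd (by omega) ha hb ha0.ne' hroot
  obtain ⟨k, hk⟩ := natDegree_minpoly_eq_two_pow_of_mem_Qclo (x := 2 * u)
    (mul_mem (ofNat_mem _ 2) hmem)
  exact hfermat ⟨k, hdeg.symm.trans hk⟩
end

section
/- If u > 0 is a real number and α, β, γ ∈ (0, π/2) satisfy 4·α + β + γ = π, cos α = 1000·u, cos β = 999·u and cos γ = 1001·u, then u does not belong to Qclo(ℚ). (This expresses that the cyclic hexagon whose six sides have distances 1000, 1000, 1000, 1000, 999, 1001 from the circumcenter is not constructible with straightedge and compass, so 6 ∈ NCD₂.) -/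
open Real

/-- The subfield `M(s)` of `ℝ`, for `s ∉ M` with `s ^ 2 ∈ M`, given explicitly as `M + M s`. -/
def quadraticExtension (M : Subfield ℝ) (s : ℝ) (hs : s ∉ M) (hs2 : s ^ 2 ∈ M) :
    Subfield ℝ where
  carrier := {x | ∃ p ∈ M, ∃ q ∈ M, x = p + q * s}
  zero_mem' := ⟨0, M.zero_mem, 0, M.zero_mem, by ring⟩
  one_mem' := ⟨1, M.one_mem, 0, M.zero_mem, by ring⟩
  add_mem' := by
    rintro _ _ ⟨p, hp, q, hq, rfl⟩ ⟨p', hp', q', hq', rfl⟩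
    exact ⟨p + p', M.add_mem hp hp', q + q', M.add_mem hq hq', by ring⟩
  neg_mem' := by
    rintro _ ⟨p, hp, q, hq, rfl⟩
    exact ⟨-p, M.neg_mem hp, -q, M.neg_mem hq, by ring⟩
  mul_mem' := by
    rintro _ _ ⟨p, hp, q, hq, rfl⟩ ⟨p', hp', q', hq', rfl⟩
    exact ⟨p * p' + q * q' * s ^ 2,
      M.add_mem (M.mul_mem hp hp') (M.mul_mem (M.mul_mem hq hq') hs2),
      p * q' + q * p', M.add_mem (M.mul_mem hp hq') (M.mul_mem hq hp'), by ring⟩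
  inv_mem' := by
    rintro _ ⟨p, hp, q, hq, rfl⟩
    by_cases hq0 : q = 0
    · exact ⟨p⁻¹, M.inv_mem hp, 0, M.zero_mem, by simp [hq0]⟩
    have hadd : p + q * s ≠ 0 := fun h ↦ hs <| by
      have : s = -p / q := by field_simp; linarith
      exact this ▸ M.div_mem (M.neg_mem hp) hq
    have hsub : p - q * s ≠ 0 := fun h ↦ hs <| by
      have : s = p / q := by field_simp; linarith
      exact this ▸ M.div_mem hp hq
    have hN : p ^ 2 - q ^ 2 * s ^ 2 ∈ M :=
      M.sub_mem (M.pow_mem hp 2) (M.mul_mem (M.pow_mem hq 2) hs2)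
    refine ⟨p / (p ^ 2 - q ^ 2 * s ^ 2), M.div_mem hp hN,
      -q / (p ^ 2 - q ^ 2 * s ^ 2), M.div_mem (M.neg_mem hq) hN, ?_⟩
    have hfac : p ^ 2 - q ^ 2 * s ^ 2 = (p + q * s) * (p - q * s) := by ring
    rw [hfac]
    field_simp
    ring

/-- A monic cubic over `M` with a root in a quadratic extension of `M` has a root in `M`. -/
theorem exists_cubic_root_mem_of_quadraticExtension (M : Subfield ℝ) {e f g s w : ℝ}
    (he : e ∈ M) (hf : f ∈ M) (hg : g ∈ M) (hs : s ∉ M) (hs2 : s ^ 2 ∈ M)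
    (hw : w ∈ quadraticExtension M s hs hs2) (hroot : w ^ 3 + e * w ^ 2 + f * w + g = 0) :
    ∃ r ∈ M, r ^ 3 + e * r ^ 2 + f * r + g = 0 := by
  obtain ⟨p, hp, q, hq, rfl⟩ := hw
  by_cases hq0 : q = 0
  · exact ⟨p, hp, by simpa [hq0] using hroot⟩
  have h2 : (2 : ℝ) ∈ M := ofNat_mem M 2
  have h3 : (3 : ℝ) ∈ M := ofNat_mem M 3
  set A := p ^ 3 + 3 * p * q ^ 2 * s ^ 2 + e * (p ^ 2 + q ^ 2 * s ^ 2) + f * p + g with hA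
  set B := 3 * p ^ 2 + q ^ 2 * s ^ 2 + 2 * e * p + f with hB
  have hqs : q ^ 2 * s ^ 2 ∈ M := M.mul_mem (M.pow_mem hq 2) hs2
  have hAM : A ∈ M := by
    refine M.add_mem (M.add_mem (M.add_mem (M.add_mem (M.pow_mem hp 3) ?_) ?_)
      (M.mul_mem hf hp)) hg
    · rw [mul_assoc]
      exact M.mul_mem (M.mul_mem h3 hp) hqs
    · exact M.mul_mem he (M.add_mem (M.pow_mem hp 2) hqs)
  have hBM : B ∈ M :=
    M.add_mem (M.add_mem (M.add_mem (M.mul_mem h3 (M.pow_mem hp 2)) hqs)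
      (M.mul_mem (M.mul_mem h2 he) hp)) hf
  have hAB : A + q * B * s = 0 := by
    rw [hA, hB]; linear_combination hroot
  have hB0 : B = 0 := by
    by_contra hB0
    refine hs ?_
    have : s = -A / (q * B) := by field_simp; linarith
    exact this ▸ M.div_mem (M.neg_mem hAM) (M.mul_mem hq hBM)
  have hA0 : A = 0 := by simpa [hB0] using hAB
  refine ⟨-e - 2 * p, M.sub_mem (M.neg_mem he) (M.mul_mem h2 hp), ?_⟩
  rw [hA] at hA0
  rw [hB] at hB0
  linear_combination hA0 + (-e - 3 * p) * hB0

/-- A root of a monic rational cubic without rational roots is not in the real quadratic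
closure of `ℚ`. -/
theorem cubic_root_notMem_Qclo {e f g : ℚ}
    (hirr : ∀ r : ℚ, r ^ 3 + e * r ^ 2 + f * r + g ≠ 0) {w : ℝ}
    (hw : w ^ 3 + e * w ^ 2 + f * w + g = 0) : w ∉ Qclo ⊥ := by
  let S : Set (Subfield ℝ) := {M | ∀ r ∈ M, r ^ 3 + e * r ^ 2 + f * r + g ≠ 0}
  have hbot : (⊥ : Subfield ℝ) ∈ S := by
    intro r hr h
    have hle : ⊥ ≤ (algebraMap ℚ ℝ).fieldRange := bot_le
    obtain ⟨r, rfl⟩ := hle hr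
    rw [eq_ratCast] at h
    exact hirr r (by exact_mod_cast h)
  obtain ⟨M, -, hM⟩ := zorn_le_nonempty₀ S (fun c hc hchain y hy ↦ by
    refine ⟨sSup c, fun r hr ↦ ?_, fun z hz ↦ le_sSup hz⟩
    obtain ⟨N, hN, hrN⟩ :=
      (Subfield.mem_sSup_of_directedOn ⟨y, hy⟩ hchain.directedOn).1 hr
    exact hc hN r hrN) ⊥ hbot
  have hsqrt : ∀ c : ℝ, c ∈ M → 0 ≤ c → √c ∈ M := by
    intro c hc hc0
    by_contra hs
    have hs2 : √c ^ 2 ∈ M := by rwa [Real.sq_sqrt hc0]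
    have hmem : quadraticExtension M (√c) hs hs2 ∈ S := by
      intro r hr h
      obtain ⟨r', hr', h'⟩ := exists_cubic_root_mem_of_quadraticExtension M
        (SubfieldClass.ratCast_mem M e) (SubfieldClass.ratCast_mem M f)
        (SubfieldClass.ratCast_mem M g) hs hs2 hr h
      exact hM.1 r' hr' h'
    have hle : M ≤ quadraticExtension M (√c) hs hs2 :=
      fun x hx ↦ ⟨x, hx, 0, M.zero_mem, by ring⟩
    exact hs (hM.2 hmem hle ⟨0, M.zero_mem, 1, M.one_mem, by ring⟩)
  have hle : Qclo ⊥ ≤ M := sInf_le ⟨bot_le, hsqrt⟩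
  exact fun h ↦ hM.1 w (hle h) hw

/-- The integral form of the cubic of the hexagon is anisotropic modulo `7`. -/
theorem hexagon_form_zmod_seven : ∀ n d : ZMod 7,
    2000000 * n ^ 3 - 7000001 * n ^ 2 * d + 8000002 * n * d ^ 2 - 3000000 * d ^ 3 = 0 →
      n = 0 ∧ d = 0 := by
  have h1 : (2000000 : ZMod 7) = 2 := by decide +kernel
  have h2 : (7000001 : ZMod 7) = 1 := by decide +kernel
  have h3 : (8000002 : ZMod 7) = 3 := by decide +kernel
  have h4 : (3000000 : ZMod 7) = 3 := by decide +kernel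
  rw [h1, h2, h3, h4]
  decide

theorem hexagon_cubic_ne_zero (r : ℚ) :
    2000000 * r ^ 3 - 7000001 * r ^ 2 + 8000002 * r - 3000000 ≠ 0 := by
  intro h
  have hd : (r.den : ℚ) ≠ 0 := by exact_mod_cast r.den_nz
  have hr : r * r.den = r.num := Rat.mul_den_eq_num r
  have hQ : (2000000 * r.num ^ 3 - 7000001 * r.num ^ 2 * r.den
      + 8000002 * r.num * r.den ^ 2 - 3000000 * r.den ^ 3 : ℚ) = 0 := by
    rw [← hr]
    linear_combination (r.den : ℚ) ^ 3 * h
  have hZ : 2000000 * r.num ^ 3 - 7000001 * r.num ^ 2 * (r.den : ℤ)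
      + 8000002 * r.num * (r.den : ℤ) ^ 2 - 3000000 * (r.den : ℤ) ^ 3 = 0 := by
    exact_mod_cast hQ
  have h7 := congrArg (Int.cast : ℤ → ZMod 7) hZ
  push_cast at h7
  obtain ⟨hn0, hd0⟩ := hexagon_form_zmod_seven _ _ h7
  rw [ZMod.intCast_zmod_eq_zero_iff_dvd] at hn0
  rw [ZMod.natCast_eq_zero_iff] at hd0
  have hdvd := Nat.dvd_gcd (Int.natCast_dvd.1 hn0) hd0
  rw [r.reduced.gcd_eq_one] at hdvd
  norm_num at hdvd

/-- If `u > 0` and `α, β, γ ∈ (0, π/2)` satisfy `4α + β + γ = π`, `cos α = 1000u`,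
`cos β = 999u`, `cos γ = 1001u`, then `u` is not in the real quadratic closure of `ℚ`
(the prime subfield `⊥` of `ℝ`); i.e., the cyclic hexagon with side distances
`1000, 1000, 1000, 1000, 999, 1001` from the circumcenter is non-constructible. -/
theorem statement3 (u α β γ : ℝ) (hu : 0 < u)
    (hα : α ∈ Set.Ioo 0 (π / 2)) (hβ : β ∈ Set.Ioo 0 (π / 2))
    (hγ : γ ∈ Set.Ioo 0 (π / 2))
    (hsum : 4 * α + β + γ = π)
    (h1 : Real.cos α = 1000 * u) (h2 : Real.cos β = 999 * u)
    (h3 : Real.cos γ = 1001 * u) :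
    u ∉ Qclo ⊥ := by
  intro hmem
  have hcos : cos (β + γ) = -cos (4 * α) := by
    rw [← cos_pi_sub]
    congr 1
    linarith
  have hcos4 : cos (4 * α) = 8 * cos α ^ 4 - 8 * cos α ^ 2 + 1 := by
    rw [show 4 * α = 2 * (2 * α) by ring, cos_two_mul, cos_two_mul]
    ring
  rw [cos_add, hcos4] at hcos
  have hsin : (cos β * cos γ + (8 * cos α ^ 4 - 8 * cos α ^ 2 + 1)) ^ 2
      = (1 - cos β ^ 2) * (1 - cos γ ^ 2) := by
    rw [← sin_sq, ← sin_sq, ← mul_pow]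
    congr 1
    linarith
  rw [h1, h2, h3] at hsin
  have hcubic : 2000000 * (2000000 * u ^ 2) ^ 3 - 7000001 * (2000000 * u ^ 2) ^ 2
      + 8000002 * (2000000 * u ^ 2) - 3000000 = 0 := by
    refine (mul_eq_zero.1 ?_).resolve_left (pow_ne_zero 2 hu.ne')
    linear_combination hsin / 4
  have hw : 2000000 * u ^ 2 ∈ Qclo ⊥ :=
    (Qclo ⊥).mul_mem (ofNat_mem _ 2000000) ((Qclo ⊥).pow_mem hmem 2)
  refine cubic_root_notMem_Qclo (e := -7000001 / 2000000) (f := 8000002 / 2000000)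
    (g := -3000000 / 2000000) (fun r hr ↦ hexagon_cubic_ne_zero r ?_) ?_ hw
  · linear_combination 2000000 * hr
  · push_cast
    linear_combination hcubic / 2000000
end

section
/- Let k be an even positive integer and define c_k(x) := Σ_{j even, 0≤j≤k} (−1)^{j/2} · C(k,j) · (1−x²)^{(k−j)/2} · x^j. Then c_k is a polynomial with integer coefficients of degree exactly k, its leading coefficient is (−1)^{k/2}·2^{k−1}, and for every real number α one has c_k(sin α) = cos(k·α). -/
open Polynomial

/-- For even `k`, `cosPoly k` is
`Σ_{j even, 0 ≤ j ≤ k} (−1)^{j/2} · C(k,j) · (1−x²)^{(k−j)/2} · x^j ∈ ℤ[x]`. -/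
noncomputable def cosPoly (k : ℕ) : Polynomial ℤ :=
  ∑ j ∈ Finset.range (k + 1),
    if Even j then
      ((-1 : ℤ) ^ (j / 2) * (k.choose j)) • ((1 - X ^ 2) ^ ((k - j) / 2) * X ^ j)
    else 0

theorem re_sin_mul_I_pow_mul_cos_pow {k j : ℕ} (heven : Even k) (hj : j ≤ k) (α : ℝ) :
    (((Real.sin α : ℂ) * Complex.I) ^ j * (Real.cos α : ℂ) ^ (k - j) * (k.choose j : ℂ)).re =
      if Even j then
        ((-1 : ℝ) ^ (j / 2) * k.choose j) *
          ((1 - Real.sin α ^ 2) ^ ((k - j) / 2) * Real.sin α ^ j)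
      else 0 := by
  obtain ⟨n, rfl⟩ := even_iff_exists_two_mul.mp heven
  rcases Nat.even_or_odd' j with ⟨m, rfl | rfl⟩
  · have hsub : 2 * n - 2 * m = 2 * (n - m) := by omega
    have key : ((Real.sin α : ℂ) * Complex.I) ^ (2 * m) * (Real.cos α : ℂ) ^ (2 * n - 2 * m) *
        ((2 * n).choose (2 * m) : ℂ) =
        (((-1 : ℝ) ^ m * (2 * n).choose (2 * m) *
          ((Real.cos α ^ 2) ^ (n - m) * Real.sin α ^ (2 * m)) : ℝ) : ℂ) := by
      rw [hsub, mul_pow, pow_mul Complex.I, Complex.I_sq, pow_mul (Real.cos α : ℂ)]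
      push_cast
      ring
    rw [key, Complex.ofReal_re, if_pos (even_two_mul m), hsub,
      Nat.mul_div_cancel_left _ two_pos, Nat.mul_div_cancel_left _ two_pos, Real.cos_sq']
  · have key : ((Real.sin α : ℂ) * Complex.I) ^ (2 * m + 1) *
        (Real.cos α : ℂ) ^ (2 * n - (2 * m + 1)) * ((2 * n).choose (2 * m + 1) : ℂ) =
        (((-1 : ℝ) ^ m * (2 * n).choose (2 * m + 1) *
          (Real.cos α ^ (2 * n - (2 * m + 1)) * Real.sin α ^ (2 * m + 1)) : ℝ) : ℂ) *
          Complex.I := by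
      rw [mul_pow, pow_succ Complex.I, pow_mul Complex.I, Complex.I_sq]
      push_cast
      ring
    rw [key, Complex.re_ofReal_mul, Complex.I_re, mul_zero,
      if_neg (Nat.not_even_iff_odd.mpr (odd_two_mul_add_one m))]

theorem aeval_sin_cosPoly {k : ℕ} (heven : Even k) (α : ℝ) :
    aeval (Real.sin α) (cosPoly k) = Real.cos (k * α) := by
  have moivre : Real.cos (k * α) =
      (((Real.sin α : ℂ) * Complex.I + (Real.cos α : ℂ)) ^ k).re := by
    rw [add_comm, Complex.ofReal_cos, Complex.ofReal_sin,
      Complex.cos_add_sin_mul_I_pow]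
    rw [← Complex.ofReal_natCast, ← Complex.ofReal_mul, ← Complex.ofReal_cos,
      ← Complex.ofReal_sin, Complex.add_re, Complex.re_ofReal_mul, Complex.I_re, mul_zero,
      add_zero, Complex.ofReal_re]
  rw [moivre, add_pow, Complex.re_sum, cosPoly, map_sum]
  refine Finset.sum_congr rfl fun j hj => ?_
  rw [re_sin_mul_I_pow_mul_cos_pow heven (Finset.mem_range_succ_iff.mp hj)]
  split_ifs <;> simp

theorem eval_sin_chebyshev_T {k : ℕ} (heven : Even k) (α : ℝ) :
    (Chebyshev.T ℝ k).eval (Real.sin α) = (-1) ^ (k / 2) * Real.cos (k * α) := by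
  obtain ⟨n, rfl⟩ := even_iff_exists_two_mul.mp heven
  rw [← Real.cos_pi_div_two_sub, Chebyshev.T_real_cos, Nat.mul_div_cancel_left _ two_pos]
  have harg : (((2 * n : ℕ) : ℤ) : ℝ) * (Real.pi / 2 - α) =
      n * Real.pi - (2 * n : ℕ) * α := by
    push_cast
    ring
  rw [harg, Real.cos_nat_mul_pi_sub]

theorem cosPoly_eq_chebyshev_T {k : ℕ} (heven : Even k) :
    cosPoly k = C ((-1) ^ (k / 2)) * Chebyshev.T ℤ k := by
  apply map_injective (Int.castRingHom ℝ) Int.cast_injective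
  refine eq_of_infinite_eval_eq _ _
    ((Set.Icc_infinite (by norm_num : (-1 : ℝ) < 1)).mono fun x hx => ?_)
  have hsin : Real.sin (Real.arcsin x) = x := Real.sin_arcsin hx.1 hx.2
  have hleft := aeval_sin_cosPoly heven (Real.arcsin x)
  have hright := eval_sin_chebyshev_T heven (Real.arcsin x)
  rw [hsin] at hleft hright
  rw [Set.mem_ofPred_eq, eval_map, ← algebraMap_int_eq, ← aeval_def, hleft, algebraMap_int_eq,
    Polynomial.map_mul, Chebyshev.map_T, eval_mul, hright, map_C, eval_C, ← mul_assoc]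
  simp [← mul_pow]

/-- For even `k ≥ 1`, `cosPoly k` has degree exactly `k`, leading coefficient
`(−1)^{k/2}·2^{k−1}`, and satisfies `cosPoly k (sin α) = cos (k·α)` for all real `α`. -/
theorem statement6 (k : ℕ) (hk : 0 < k) (heven : Even k) :
    (cosPoly k).natDegree = k ∧
    (cosPoly k).leadingCoeff = (-1 : ℤ) ^ (k / 2) * 2 ^ (k - 1) ∧
    ∀ α : ℝ, Polynomial.aeval (Real.sin α) (cosPoly k) = Real.cos (k * α) := by
  have hsign : ((-1 : ℤ) ^ (k / 2)) ≠ 0 := pow_ne_zero _ (by norm_num)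
  refine ⟨?_, ?_, aeval_sin_cosPoly heven⟩
  · rw [cosPoly_eq_chebyshev_T heven, natDegree_C_mul hsign, Chebyshev.natDegree_T,
      Int.natAbs_natCast]
  · rw [cosPoly_eq_chebyshev_T heven, leadingCoeff_mul, leadingCoeff_C,
      Chebyshev.leadingCoeff_T, Int.natAbs_natCast]
end

section
/- Let k, m be positive integers and let a, b be positive real numbers. Define the polynomial W_{k,m}(a,b,x) in the variable x as follows: W_{k,m}(a,b,x) = s_k(ax) − s_m(bx) if k and m are both odd; W_{k,m}(a,b,x) = c_k(ax) + c_m(bx) if k and m are both even; W_{k,m}(a,b,x) = s_k(ax)² + c_m(bx)² − 1 if k is odd and m is even; and W_{k,m}(a,b,x) = c_k(ax)² + s_m(bx)² − 1 if k is even and m is odd. Then: (i) if a ≠ b, or k ≠ m, or k = m is even, then W_{k,m}(a,b,x) is not the zero polynomial in x; and (ii) whenever α, β, u are real numbers with k·α + m·β = π, sin α = a·u and sin β = b·u, one has W_{k,m}(a,b,u) = 0. -/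
open Polynomial

/-- `sinPolyR k a` is `Σ_{j odd, 1 ≤ j ≤ k} (−1)^{(j−1)/2} C(k,j) (1−a²x²)^{(k−j)/2} (a·x)^j`,
the real polynomial `s_k(a·x)` (for odd `k`). -/
noncomputable def sinPolyR (k : ℕ) (a : ℝ) : Polynomial ℝ :=
  ∑ j ∈ Finset.Icc 1 k,
    if Odd j then
      ((-1 : ℝ) ^ ((j - 1) / 2) * (k.choose j)) •
        ((1 - (C a) ^ 2 * X ^ 2) ^ ((k - j) / 2) * (C a * X) ^ j)
    else 0

/-- `cosPolyR k a` is `Σ_{j even, 0 ≤ j ≤ k} (−1)^{j/2} C(k,j) (1−a²x²)^{(k−j)/2} (a·x)^j`,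
the real polynomial `c_k(a·x)` (for even `k`). -/
noncomputable def cosPolyR (k : ℕ) (a : ℝ) : Polynomial ℝ :=
  ∑ j ∈ Finset.range (k + 1),
    if Even j then
      ((-1 : ℝ) ^ (j / 2) * (k.choose j)) •
        ((1 - (C a) ^ 2 * X ^ 2) ^ ((k - j) / 2) * (C a * X) ^ j)
    else 0

/-- The polynomial `W_{k,m}(a,b,x)`, split into four cases according to the parities
of `k` and `m`. -/
noncomputable def Wpoly (k m : ℕ) (a b : ℝ) : Polynomial ℝ :=
  if Odd k then
    (if Odd m then sinPolyR k a - sinPolyR m b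
     else (sinPolyR k a) ^ 2 + (cosPolyR m b) ^ 2 - 1)
  else
    (if Odd m then (cosPolyR k a) ^ 2 + (sinPolyR m b) ^ 2 - 1
     else cosPolyR k a + cosPolyR m b)

open Finset in
theorem cos_nat_mul_and_sin_nat_mul_eq_sum (k : ℕ) (α : ℝ) :
    Real.cos (k * α) = (∑ j ∈ range (k + 1),
      ((Real.sin α * Complex.I) ^ j * Real.cos α ^ (k - j) * (k.choose j : ℂ)).re) ∧
    Real.sin (k * α) = (∑ j ∈ range (k + 1),
      ((Real.sin α * Complex.I) ^ j * Real.cos α ^ (k - j) * (k.choose j : ℂ)).im) := by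
  rw [← Complex.re_sum, ← Complex.im_sum, ← add_pow, add_comm, Complex.ofReal_cos,
    Complex.ofReal_sin, Complex.cos_add_sin_mul_I_pow]
  have h1 : Complex.cos (k * α) = (Real.cos (k * α) : ℝ) := by push_cast; rfl
  have h2 : Complex.sin (k * α) = (Real.sin (k * α) : ℝ) := by push_cast; rfl
  rw [h1, h2]
  constructor <;> simp [-Complex.ofReal_cos, -Complex.ofReal_sin]

theorem ofReal_mul_I_pow_two_mul (s : ℝ) (i : ℕ) :
    ((s : ℂ) * Complex.I) ^ (2 * i) = (((-1) ^ i * s ^ (2 * i) : ℝ) : ℂ) := by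
  rw [pow_mul, mul_pow, Complex.I_sq, pow_mul s]
  push_cast
  ring

theorem one_sub_sin_sq_pow {k j : ℕ} (h : Even (k - j)) (α : ℝ) :
    (1 - Real.sin α ^ 2) ^ ((k - j) / 2) = Real.cos α ^ (k - j) := by
  rw [← Real.cos_sq', ← pow_mul, Nat.mul_div_cancel' h.two_dvd]

theorem eval_cosPolyR {k : ℕ} (hk : Even k) {a u α : ℝ} (h : Real.sin α = a * u) :
    (cosPolyR k a).eval u = Real.cos (k * α) := by
  rw [(cos_nat_mul_and_sin_nat_mul_eq_sum k α).1, cosPolyR, eval_finsetSum]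
  refine Finset.sum_congr rfl fun j hj => ?_
  have hjk : j ≤ k := Nat.lt_succ_iff.mp (Finset.mem_range.mp hj)
  split_ifs with hj2
  · have hc := one_sub_sin_sq_pow ((Nat.even_sub hjk).2 (iff_of_true hk hj2)) α
    obtain ⟨i, rfl⟩ := hj2.two_dvd
    rw [ofReal_mul_I_pow_two_mul, ← Complex.ofReal_pow, ← Complex.ofReal_natCast,
      ← Complex.ofReal_mul, ← Complex.ofReal_mul, Complex.ofReal_re, ← hc, h]
    simp only [eval_smul, eval_mul, eval_pow, eval_sub, eval_one, eval_C, eval_X, smul_eq_mul,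
      mul_pow, Nat.mul_div_cancel_left i two_pos]
    ring
  · obtain ⟨i, rfl⟩ := Nat.not_even_iff_odd.mp hj2
    rw [pow_succ, ofReal_mul_I_pow_two_mul, ← Complex.ofReal_pow, ← Complex.ofReal_natCast]
    simp [-Complex.ofReal_cos, -Complex.ofReal_sin, -Complex.ofReal_pow, -Complex.ofReal_mul,
      -Complex.ofReal_natCast]

theorem eval_sinPolyR {k : ℕ} (hk : Odd k) {a u α : ℝ} (h : Real.sin α = a * u) :
    (sinPolyR k a).eval u = Real.sin (k * α) := by
  rw [(cos_nat_mul_and_sin_nat_mul_eq_sum k α).2, sinPolyR, eval_finsetSum,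
    Finset.range_eq_Ico, ← Finset.sum_subset (s₁ := Finset.Icc 1 k) (s₂ := Finset.Ico 0 (k + 1))]
  · refine Finset.sum_congr rfl fun j hj => ?_
    have hjk : j ≤ k := (Finset.mem_Icc.mp hj).2
    split_ifs with hj2
    · have hc := one_sub_sin_sq_pow (Nat.Odd.sub_odd hk hj2) α
      obtain ⟨i, rfl⟩ := hj2
      rw [pow_succ (_ * Complex.I), ofReal_mul_I_pow_two_mul, ← Complex.ofReal_pow,
        ← Complex.ofReal_natCast]
      have : ∀ x y z w : ℝ, ((x : ℂ) * (y * Complex.I) * z * w).im = x * y * z * w := by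
        intro x y z w
        simp
      rw [this, ← hc, h]
      simp only [eval_smul, eval_mul, eval_pow, eval_sub, eval_one, eval_C, eval_X, smul_eq_mul,
        mul_pow, Nat.add_sub_cancel, Nat.mul_div_cancel_left i two_pos]
      ring
    · obtain ⟨i, rfl⟩ := (Nat.not_odd_iff_even.mp hj2).two_dvd
      rw [ofReal_mul_I_pow_two_mul, ← Complex.ofReal_pow, ← Complex.ofReal_natCast,
        ← Complex.ofReal_mul, ← Complex.ofReal_mul, Complex.ofReal_im, eval_zero]
  · intro j hj
    rw [Finset.mem_Icc] at hj
    rw [Finset.mem_Ico]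
    omega
  · intro j hj hj'
    obtain rfl : j = 0 := by
      rw [Finset.mem_Icc] at hj'
      rw [Finset.mem_Ico] at hj
      omega
    rw [pow_zero, one_mul, ← Complex.ofReal_pow, ← Complex.ofReal_natCast, ← Complex.ofReal_mul,
      Complex.ofReal_im]

theorem infinite_setOf_exists_sin_eq {a : ℝ} (ha : 0 < a) :
    {u : ℝ | ∃ α : ℝ, Real.sin α = a * u}.Infinite := by
  refine (Set.Icc_infinite (show (0 : ℝ) < 1 / a by positivity)).mono fun u hu => ?_
  refine ⟨Real.arcsin (a * u), Real.sin_arcsin ?_ ?_⟩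
  · linarith [mul_nonneg ha.le hu.1]
  · rw [mul_comm]
    exact (le_div_iff₀ ha).mp hu.2

theorem eval_T_comp {k : ℕ} {a u α : ℝ} (h : Real.sin α = a * u) :
    ((Chebyshev.T ℝ k).comp (C a * X)).eval u = Real.cos (k * (Real.pi / 2 - α)) := by
  have := Chebyshev.T_real_cos (Real.pi / 2 - α) k
  rw [Real.cos_pi_div_two_sub, h] at this
  simpa using this

theorem sinPolyR_eq_T {k : ℕ} (hk : Odd k) {a : ℝ} (ha : 0 < a) :
    sinPolyR k a = C ((-1) ^ (k / 2)) * (Chebyshev.T ℝ k).comp (C a * X) := by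
  refine eq_of_infinite_eval_eq _ _ ((infinite_setOf_exists_sin_eq ha).mono ?_)
  rintro u ⟨α, h⟩
  rw [Set.mem_ofPred_eq, eval_sinPolyR hk h, eval_mul, eval_C, eval_T_comp h]
  obtain ⟨i, rfl⟩ := hk
  rw [show (2 * i + 1) / 2 = i by omega]
  have : ((2 * i + 1 : ℕ) : ℝ) * (Real.pi / 2 - α)
      = Real.pi / 2 - (2 * i + 1 : ℕ) * α + i * Real.pi := by
    push_cast
    ring
  rw [this, Real.cos_add_nat_mul_pi, Real.cos_pi_div_two_sub, ← mul_assoc, ← mul_pow]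
  norm_num

theorem cosPolyR_eq_T {k : ℕ} (hk : Even k) {a : ℝ} (ha : 0 < a) :
    cosPolyR k a = C ((-1) ^ (k / 2)) * (Chebyshev.T ℝ k).comp (C a * X) := by
  refine eq_of_infinite_eval_eq _ _ ((infinite_setOf_exists_sin_eq ha).mono ?_)
  rintro u ⟨α, h⟩
  rw [Set.mem_ofPred_eq, eval_cosPolyR hk h, eval_mul, eval_C, eval_T_comp h]
  obtain ⟨i, rfl⟩ := hk
  rw [show (i + i) / 2 = i by omega]
  have : ((i + i : ℕ) : ℝ) * (Real.pi / 2 - α) = i * Real.pi - (i + i : ℕ) * α := by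
    push_cast
    ring
  rw [this, Real.cos_nat_mul_pi_sub, ← mul_assoc, ← mul_pow]
  norm_num

theorem natDegree_T_comp (k : ℕ) {a : ℝ} (ha : 0 < a) :
    ((Chebyshev.T ℝ k).comp (C a * X)).natDegree = k := by
  rw [natDegree_comp, natDegree_C_mul_X a ha.ne', Chebyshev.natDegree_T]
  simp

theorem leadingCoeff_T_comp (k : ℕ) {a : ℝ} (ha : 0 < a) :
    ((Chebyshev.T ℝ k).comp (C a * X)).leadingCoeff = 2 ^ (k - 1) * a ^ k := by
  rw [leadingCoeff_comp (by rw [natDegree_C_mul_X a ha.ne']; exact one_ne_zero),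
    Chebyshev.leadingCoeff_T, leadingCoeff_C_mul_X, Chebyshev.natDegree_T]
  simp

theorem natDegree_sinPolyR {k : ℕ} (hk : Odd k) {a : ℝ} (ha : 0 < a) :
    (sinPolyR k a).natDegree = k := by
  rw [sinPolyR_eq_T hk ha, natDegree_C_mul (pow_ne_zero _ (by norm_num)), natDegree_T_comp k ha]

theorem natDegree_cosPolyR {k : ℕ} (hk : Even k) {a : ℝ} (ha : 0 < a) :
    (cosPolyR k a).natDegree = k := by
  rw [cosPolyR_eq_T hk ha, natDegree_C_mul (pow_ne_zero _ (by norm_num)), natDegree_T_comp k ha]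

theorem natDegree_eq_of_sq_add_sq_sub_one_eq_zero {p q : ℝ[X]} (h : p ^ 2 + q ^ 2 - 1 = 0) :
    p.natDegree = q.natDegree := by
  have h1 : p ^ 2 = -(q ^ 2) + C 1 := by
    rw [C_1]
    linear_combination h
  have h2 := congrArg natDegree h1
  rw [natDegree_add_C, natDegree_neg, natDegree_pow, natDegree_pow] at h2
  omega

theorem Wpoly_ne_zero {k m : ℕ} (hk : 0 < k) {a b : ℝ} (ha : 0 < a) (hb : 0 < b)
    (h : a ≠ b ∨ k ≠ m ∨ (k = m ∧ Even k)) : Wpoly k m a b ≠ 0 := by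
  intro h0
  rw [Wpoly] at h0
  split_ifs at h0 with h1 h2 h2
  · have h3 := sub_eq_zero.mp h0
    have hkm : k = m := by
      rw [← natDegree_sinPolyR h1 ha, h3, natDegree_sinPolyR h2 hb]
    subst hkm
    refine h.elim (fun hab => hab ?_) (fun h' => h'.elim (fun hn => hn rfl)
      fun he => Nat.not_even_iff_odd.mpr h1 he.2)
    rw [sinPolyR_eq_T h1 ha, sinPolyR_eq_T h1 hb] at h3
    have h4 := congrArg leadingCoeff
      (mul_left_cancel₀ (C_ne_zero.mpr (pow_ne_zero _ (by norm_num))) h3)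
    rw [leadingCoeff_T_comp k ha, leadingCoeff_T_comp k hb] at h4
    exact (pow_left_inj₀ ha.le hb.le hk.ne').mp (mul_left_cancel₀ (by positivity) h4)
  · have h3 := natDegree_eq_of_sq_add_sq_sub_one_eq_zero h0
    rw [natDegree_sinPolyR h1 ha, natDegree_cosPolyR (Nat.not_odd_iff_even.mp h2) hb] at h3
    exact h2 (h3 ▸ h1)
  · have h3 := natDegree_eq_of_sq_add_sq_sub_one_eq_zero h0
    rw [natDegree_cosPolyR (Nat.not_odd_iff_even.mp h1) ha, natDegree_sinPolyR h2 hb] at h3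
    exact h1 (h3 ▸ h2)
  · have h3 := congrArg (eval 0) h0
    rw [eval_add, eval_cosPolyR (α := 0) (Nat.not_odd_iff_even.mp h1) (by simp),
      eval_cosPolyR (α := 0) (Nat.not_odd_iff_even.mp h2) (by simp)] at h3
    norm_num at h3

theorem eval_Wpoly_eq_zero {k m : ℕ} {a b α β u : ℝ} (h : k * α + m * β = Real.pi)
    (hα : Real.sin α = a * u) (hβ : Real.sin β = b * u) : (Wpoly k m a b).eval u = 0 := by
  have h' : (k : ℝ) * α = Real.pi - m * β := by linarith
  rw [Wpoly]
  split_ifs with h1 h2 h2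
  · rw [eval_sub, eval_sinPolyR h1 hα, eval_sinPolyR h2 hβ, h', Real.sin_pi_sub, sub_self]
  · rw [eval_sub, eval_add, eval_pow, eval_pow, eval_one, eval_sinPolyR h1 hα,
      eval_cosPolyR (Nat.not_odd_iff_even.mp h2) hβ, h', Real.sin_pi_sub, Real.sin_sq_add_cos_sq,
      sub_self]
  · rw [eval_sub, eval_add, eval_pow, eval_pow, eval_one,
      eval_cosPolyR (Nat.not_odd_iff_even.mp h1) hα, eval_sinPolyR h2 hβ, h', Real.cos_pi_sub,
      neg_sq, Real.cos_sq_add_sin_sq, sub_self]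
  · rw [eval_add, eval_cosPolyR (Nat.not_odd_iff_even.mp h1) hα,
      eval_cosPolyR (Nat.not_odd_iff_even.mp h2) hβ, h', Real.cos_pi_sub, neg_add_cancel]

/-- (i) If `a ≠ b`, or `k ≠ m`, or `k = m` is even, then `W_{k,m}(a,b,x)` is not the zero
polynomial; (ii) whenever `k·α + m·β = π`, `sin α = a·u` and `sin β = b·u`, `u` is a root
of `W_{k,m}(a,b,x)`. -/
theorem statement7 (k m : ℕ) (hk : 0 < k) (hm : 0 < m) (a b : ℝ)
    (ha : 0 < a) (hb : 0 < b) :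
    ((a ≠ b ∨ k ≠ m ∨ (k = m ∧ Even k)) → Wpoly k m a b ≠ 0) ∧
    (∀ α β u : ℝ, (k : ℝ) * α + (m : ℝ) * β = Real.pi →
      Real.sin α = a * u → Real.sin β = b * u →
      (Wpoly k m a b).eval u = 0) :=
  ⟨Wpoly_ne_zero hk ha hb, fun _ _ _ => eval_Wpoly_eq_zero⟩
end

section
/- Let k ∈ {1, 2, 3}, let a, b be positive real numbers, and let u > 0 and α, β ∈ (0, π/2) satisfy k·α + (6−k)·β = π, sin α = a·u and sin β = b·u. Then u belongs to Qclo(ℚ(a,b)). (This expresses that a cyclic hexagon with at most two distinct side lengths, k sides of length a and 6−k sides of length b, is always constructible with straightedge and compass from its side lengths.) -/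
open Real

theorem Subfield.mem_of_sq_mem {M : Subfield ℝ}
    (hM : ∀ c : ℝ, c ∈ M → 0 ≤ c → Real.sqrt c ∈ M) {x : ℝ} (hx : x ^ 2 ∈ M) : x ∈ M := by
  have h := hM _ hx (sq_nonneg x)
  rw [Real.sqrt_sq_eq_abs] at h
  rcases abs_choice x with hc | hc <;> rw [hc] at h
  · exact h
  · exact neg_mem_iff.mp h

theorem Real.sin_five_mul (x : ℝ) :
    Real.sin (5 * x) = Real.sin x * (16 * (Real.sin x ^ 2) ^ 2 - 20 * Real.sin x ^ 2 + 5) := by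
  rw [show 5 * x = 3 * x + 2 * x by ring, Real.sin_add, Real.sin_three_mul, Real.cos_three_mul,
    Real.sin_two_mul, Real.cos_two_mul]
  linear_combination
    (8 * Real.sin x * Real.cos x ^ 2 - 16 * Real.sin x ^ 3 + 8 * Real.sin x) *
      Real.sin_sq_add_cos_sq x

/-- If `k ∈ {1,2,3}`, `a, b > 0`, `u > 0` and `α, β ∈ (0, π/2)` satisfy
`k·α + (6−k)·β = π`, `sin α = a·u`, `sin β = b·u`, then `u` lies in the real quadratic
closure of `ℚ(a,b)`; i.e., a cyclic hexagon with at most two distinct side lengths is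
constructible from its side lengths. -/
theorem statement9 (k : ℕ) (hk : k ∈ ({1, 2, 3} : Set ℕ)) (a b u α β : ℝ)
    (ha : 0 < a) (hb : 0 < b) (hu : 0 < u)
    (hα : α ∈ Set.Ioo 0 (π / 2)) (hβ : β ∈ Set.Ioo 0 (π / 2))
    (hsum : (k : ℝ) * α + ((6 - k : ℕ) : ℝ) * β = π)
    (h1 : Real.sin α = a * u) (h2 : Real.sin β = b * u) :
    u ∈ Qclo (Subfield.closure {a, b}) := by
  rw [Qclo, Subfield.mem_sInf]
  rintro M ⟨hK, hM⟩
  have haM : a ∈ M := hK (Subfield.subset_closure (by simp))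
  have hbM : b ∈ M := hK (Subfield.subset_closure (by simp))
  have hn (n : ℕ) : (n : ℝ) ∈ M := natCast_mem M n
  simp only [Set.mem_insert_iff, Set.mem_singleton_iff] at hk
  rcases hk with rfl | rfl | rfl <;> norm_num at hsum
  · have hsin : a * u = b * u * (16 * ((b * u) ^ 2) ^ 2 - 20 * (b * u) ^ 2 + 5) := by
      rw [← h1, ← h2, ← Real.sin_five_mul, ← Real.sin_pi_sub (5 * β)]
      congr 1
      linarith
    have hquad : a = b * (16 * ((b * u) ^ 2) ^ 2 - 20 * (b * u) ^ 2 + 5) :=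
      mul_right_cancel₀ hu.ne' (by linear_combination hsin)
    have hdisc : (32 * (b * u) ^ 2 - 20) ^ 2 = (80 : ℕ) + (64 : ℕ) * (a / b) := by
      have : a / b = 16 * ((b * u) ^ 2) ^ 2 - 20 * (b * u) ^ 2 + 5 := by
        rw [div_eq_iff hb.ne']
        linarith
      rw [this]
      push_cast
      ring
    have hroot : 32 * (b * u) ^ 2 - 20 ∈ M := Subfield.mem_of_sq_mem hM <| by
      rw [hdisc]
      exact add_mem (hn _) (mul_mem (hn _) (div_mem haM hbM))
    have hbu : b * u ∈ M := Subfield.mem_of_sq_mem hM <| by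
      have := div_mem (add_mem hroot (hn 20)) (hn 32)
      convert this using 1
      push_cast
      ring
    simpa [hb.ne'] using div_mem hbu hbM
  · have hsin : a * u = 1 - 2 * (b * u) ^ 2 := by
      rw [← h1, ← h2, show α = π / 2 - 2 * β by linarith, Real.sin_pi_div_two_sub,
        Real.cos_two_mul, Real.cos_sq']
      ring
    have hroot : (4 : ℕ) * b ^ 2 * u + a ∈ M := Subfield.mem_of_sq_mem hM <| by
      have : ((4 : ℕ) * b ^ 2 * u + a) ^ 2 = a ^ 2 + (8 : ℕ) * b ^ 2 := by
        push_cast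
        linear_combination 8 * b ^ 2 * hsin
      rw [this]
      exact add_mem (pow_mem haM 2) (mul_mem (hn _) (pow_mem hbM 2))
    have := div_mem (sub_mem hroot haM) (mul_mem (hn 4) (pow_mem hbM 2))
    convert this using 1
    field_simp
    ring
  · have hsin : a * u = √3 / 2 * Real.cos β - 1 / 2 * (b * u) := by
      rw [← h1, ← h2, show α = π / 3 - β by linarith, Real.sin_sub, Real.sin_pi_div_three,
        Real.cos_pi_div_three]
    have hcos : (2 * (a * u) + b * u) ^ 2 = 3 * (1 - (b * u) ^ 2) := by
      rw [hsin, ← h2, ← Real.cos_sq']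
      linear_combination Real.cos β ^ 2 * Real.sq_sqrt (show (0 : ℝ) ≤ 3 by norm_num)
    refine Subfield.mem_of_sq_mem hM ?_
    have hden : a ^ 2 + a * b + b ^ 2 ≠ 0 := by positivity
    have hsq : u ^ 2 = (3 : ℕ) / ((4 : ℕ) * (a ^ 2 + a * b + b ^ 2)) := by
      rw [eq_div_iff (by positivity)]
      push_cast
      linear_combination hcos
    rw [hsq]
    exact div_mem (hn _) (mul_mem (hn _)
      (add_mem (add_mem (pow_mem haM 2) (mul_mem haM hbM)) (pow_mem hbM 2)))
end

section
/- If u > 0 is a real number and κ₁, κ₂, κ₃ ∈ (0, π) satisfy κ₁ + κ₂ + κ₃ = π, cos κ₁ = 1 − 2·u, cos κ₂ = 1 − 8·u and cos κ₃ = 1 − 18·u, then u does not belong to Qclo(ℚ). (This expresses that the cyclic hexagon with side lengths 1, 1, 2, 2, 3, 3 exists but is not constructible with straightedge and compass from its side lengths, so 6 ∈ NCL₃.) -/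
open Real

/-- The subfield `K(s)` of `ℝ` for `s ∉ K` with `s ^ 2 ∈ K`, with elements written `a + b * s`. -/
def Subfield.adjoinSquareRoot (K : Subfield ℝ) (s : ℝ) (hs : s ^ 2 ∈ K) (hsK : s ∉ K) :
    Subfield ℝ where
  carrier := {x | ∃ a ∈ K, ∃ b ∈ K, x = a + b * s}
  mul_mem' := by
    rintro _ _ ⟨a, ha, b, hb, rfl⟩ ⟨a', ha', b', hb', rfl⟩
    exact ⟨a * a' + b * b' * s ^ 2,
      add_mem (mul_mem ha ha') (mul_mem (mul_mem hb hb') hs),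
      a * b' + b * a', add_mem (mul_mem ha hb') (mul_mem hb ha'), by ring⟩
  one_mem' := ⟨1, one_mem K, 0, zero_mem K, by ring⟩
  add_mem' := by
    rintro _ _ ⟨a, ha, b, hb, rfl⟩ ⟨a', ha', b', hb', rfl⟩
    exact ⟨a + a', add_mem ha ha', b + b', add_mem hb hb', by ring⟩
  zero_mem' := ⟨0, zero_mem K, 0, zero_mem K, by ring⟩
  neg_mem' := by
    rintro _ ⟨a, ha, b, hb, rfl⟩
    exact ⟨-a, neg_mem ha, -b, neg_mem hb, by ring⟩
  inv_mem' := by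
    rintro _ ⟨a, ha, b, hb, rfl⟩
    by_cases hb0 : b = 0
    · exact ⟨a⁻¹, inv_mem ha, 0, zero_mem K, by simp [hb0]⟩
    have hplus : a + b * s ≠ 0 := fun h => hsK (by
      have : s = -a / b := by field_simp; linarith
      exact this ▸ div_mem (neg_mem ha) hb)
    have hminus : a - b * s ≠ 0 := fun h => hsK (by
      have : s = a / b := by field_simp; linarith
      exact this ▸ div_mem ha hb)
    have hN : a ^ 2 - b ^ 2 * s ^ 2 ∈ K :=
      sub_mem (pow_mem ha 2) (mul_mem (pow_mem hb 2) hs)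
    have hN0 : a ^ 2 - b ^ 2 * s ^ 2 ≠ 0 := by
      convert mul_ne_zero hplus hminus using 1
      ring
    refine ⟨a / (a ^ 2 - b ^ 2 * s ^ 2), div_mem ha hN,
      -b / (a ^ 2 - b ^ 2 * s ^ 2), div_mem (neg_mem hb) hN, ?_⟩
    rw [inv_eq_iff_eq_inv]
    refine eq_inv_of_mul_eq_one_left ?_
    field_simp
    ring

/-- A monic cubic over `K` with a root in a quadratic extension `K(s)` has a root in `K`. -/
theorem Subfield.exists_cubic_root_of_adjoin_sqrt {K : Subfield ℝ} {p q r s a b : ℝ}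
    (hp : p ∈ K) (hq : q ∈ K) (hr : r ∈ K) (hs : s ^ 2 ∈ K) (hsK : s ∉ K)
    (ha : a ∈ K) (hb : b ∈ K)
    (h : (a + b * s) ^ 3 + p * (a + b * s) ^ 2 + q * (a + b * s) + r = 0) :
    ∃ t ∈ K, t ^ 3 + p * t ^ 2 + q * t + r = 0 := by
  by_cases hb0 : b = 0
  · subst hb0
    exact ⟨a, ha, by simpa using h⟩
  have h2 : (2 : ℝ) ∈ K := ofNat_mem K 2
  have h3 : (3 : ℝ) ∈ K := ofNat_mem K 3
  set A := a ^ 3 + 3 * a * (b ^ 2 * s ^ 2) + p * (a ^ 2 + b ^ 2 * s ^ 2) + q * a + r with hA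
  set E := 3 * a ^ 2 + b ^ 2 * s ^ 2 + 2 * p * a + q with hE
  have hd : b ^ 2 * s ^ 2 ∈ K := mul_mem (pow_mem hb 2) hs
  have hAK : A ∈ K :=
    add_mem (add_mem (add_mem (add_mem (pow_mem ha 3) (mul_mem (mul_mem h3 ha) hd))
      (mul_mem hp (add_mem (pow_mem ha 2) hd))) (mul_mem hq ha)) hr
  have hEK : E ∈ K :=
    add_mem (add_mem (add_mem (mul_mem h3 (pow_mem ha 2)) hd) (mul_mem (mul_mem h2 hp) ha)) hq
  have hAE : A + b * E * s = 0 := by rw [hA, hE]; linear_combination h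
  have hE0 : E = 0 := by
    by_contra hE0
    have hs' : s = -A / (b * E) := by
      rw [eq_div_iff (mul_ne_zero hb0 hE0)]
      linear_combination hAE
    exact hsK (hs' ▸ div_mem (neg_mem hAK) (mul_mem hb hEK))
  have hA0 : A = 0 := by simpa [hE0] using hAE
  refine ⟨-p - 2 * a, sub_mem (neg_mem hp) (mul_mem h2 ha), ?_⟩
  rw [hA] at hA0
  rw [hE] at hE0
  linear_combination hA0 + (-p - 3 * a) * hE0

/-- A monic cubic over `K` without roots in `K` has no roots in `Qclo K`. -/
theorem cubic_ne_zero_of_mem_Qclo {K : Subfield ℝ} {p q r : ℝ}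
    (hp : p ∈ K) (hq : q ∈ K) (hr : r ∈ K)
    (hK : ∀ x ∈ K, x ^ 3 + p * x ^ 2 + q * x + r ≠ 0) :
    ∀ x ∈ Qclo K, x ^ 3 + p * x ^ 2 + q * x + r ≠ 0 := by
  obtain ⟨M, hKM, hM⟩ := zorn_le_nonempty₀
    {M : Subfield ℝ | ∀ x ∈ M, x ^ 3 + p * x ^ 2 + q * x + r ≠ 0}
    (fun c hc hchain y hy => ⟨sSup c, fun x hx => by
      obtain ⟨N, hN, hxN⟩ := (Subfield.mem_sSup_of_directedOn ⟨y, hy⟩ hchain.directedOn).1 hx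
      exact hc hN x hxN, fun _ => le_sSup⟩) K hK
  have hclosed : ∀ c : ℝ, c ∈ M → 0 ≤ c → √c ∈ M := by
    intro c hc hc0
    by_contra hsM
    have hs : √c ^ 2 ∈ M := by rwa [Real.sq_sqrt hc0]
    let N := M.adjoinSquareRoot (√c) hs hsM
    have hMN : M ≤ N := fun x hx => ⟨x, hx, 0, zero_mem M, by ring⟩
    have hsN : √c ∈ N := ⟨0, zero_mem M, 1, one_mem M, by ring⟩
    have hN : ∀ x ∈ N, x ^ 3 + p * x ^ 2 + q * x + r ≠ 0 := by
      rintro _ ⟨a, ha, b, hb, rfl⟩ h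
      obtain ⟨t, ht, ht0⟩ := Subfield.exists_cubic_root_of_adjoin_sqrt
        (hKM hp) (hKM hq) (hKM hr) hs hsM ha hb h
      exact hM.prop t ht ht0
    exact hsM (hM.le_of_ge hN hMN hsN)
  intro x hx
  exact hM.prop x (Subfield.mem_sInf.1 hx M ⟨hKM, hclosed⟩)

/-- The cubic `x ^ 3 - 14 x ^ 2 + 49 x - 18` has no rational root. -/
theorem rat_cubic_ne_zero (x : ℚ) : x ^ 3 + -14 * x ^ 2 + 49 * x + -18 ≠ 0 := by
  intro h
  have hint : IsIntegral ℤ x := by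
    refine ⟨Polynomial.X ^ 3 + (Polynomial.C (-14) * Polynomial.X ^ 2
      + Polynomial.C 49 * Polynomial.X + Polynomial.C (-18)), ?_, ?_⟩
    · monicity!
    · simp
      linear_combination h
  obtain ⟨n, rfl⟩ := IsIntegrallyClosed.isIntegral_iff.1 hint
  have hn : n * (n - 7) ^ 2 = 18 := by
    have h' : ((n * (n - 7) ^ 2 : ℤ) : ℚ) = 18 := by
      push_cast
      simp only [eq_intCast] at h
      linear_combination h
    exact_mod_cast h'
  have hpos : 0 < n := by
    by_contra! hle
    nlinarith [mul_nonneg (neg_nonneg.2 hle) (sq_nonneg (n - 7))]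
  have hlt : n < 12 := by
    by_contra! hge
    nlinarith
  interval_cases n <;> omega

/-- If three angles sum to `π`, then their cosines satisfy
`x ^ 2 + y ^ 2 + z ^ 2 + 2 * x * y * z = 1`. -/
theorem cos_sq_add_cos_sq_add_cos_sq {α β γ : ℝ} (h : α + β + γ = π) :
    Real.cos α ^ 2 + Real.cos β ^ 2 + Real.cos γ ^ 2
      + 2 * Real.cos α * Real.cos β * Real.cos γ = 1 := by
  have hγ : γ = π - (α + β) := by linarith
  rw [hγ, Real.cos_pi_sub, Real.cos_add]
  have hα := Real.sin_sq_add_cos_sq α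
  have hβ := Real.sin_sq_add_cos_sq β
  linear_combination Real.sin β ^ 2 * hα + (1 - Real.cos α ^ 2) * hβ

/-- If `u > 0` and `κ₁, κ₂, κ₃ ∈ (0, π)` satisfy `κ₁ + κ₂ + κ₃ = π`,
`cos κ₁ = 1 − 2u`, `cos κ₂ = 1 − 8u`, `cos κ₃ = 1 − 18u`, then `u` is not in the real
quadratic closure of `ℚ` (the prime subfield `⊥` of `ℝ`); i.e., the cyclic hexagon with
side lengths `1, 1, 2, 2, 3, 3` is non-constructible, so `6 ∈ NCL₃`. -/
theorem statement10 (u κ₁ κ₂ κ₃ : ℝ) (hu : 0 < u)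
    (h1 : κ₁ ∈ Set.Ioo 0 π) (h2 : κ₂ ∈ Set.Ioo 0 π) (h3 : κ₃ ∈ Set.Ioo 0 π)
    (hsum : κ₁ + κ₂ + κ₃ = π)
    (hc1 : Real.cos κ₁ = 1 - 2 * u) (hc2 : Real.cos κ₂ = 1 - 8 * u)
    (hc3 : Real.cos κ₃ = 1 - 18 * u) :
    u ∉ Qclo ⊥ := by
  intro hmem
  have htrig := cos_sq_add_cos_sq_add_cos_sq hsum
  rw [hc1, hc2, hc3] at htrig
  have hw : (2 * u)⁻¹ ∈ Qclo ⊥ := inv_mem (mul_mem (ofNat_mem _ 2) hmem)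
  refine cubic_ne_zero_of_mem_Qclo (p := -14) (q := 49) (r := -18)
    (neg_mem (ofNat_mem _ 14)) (ofNat_mem _ 49) (neg_mem (ofNat_mem _ 18)) ?_ _ hw ?_
  · intro x hx h
    rw [Subfield.bot_eq_of_charZero] at hx
    obtain ⟨y, rfl⟩ := hx
    exact rat_cubic_ne_zero y (by simp only [eq_ratCast] at h; exact_mod_cast h)
  · field_simp
    linear_combination (1 / 4) * htrig
end
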